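/- arXiv:2305.04071 — 2 statements merged into one kernel-verified Lean document; each statement's English description precedes it below -/
import Mathlib

section
/- Let α ≥ 1 and x₀ > 0. There exist C > 0 and θ₁ > 0 such that for all 0 < θ < θ₁: M_{x₀} < 2, B ≠ 0, and |R/θ − Γ(α+1)/(2i)^(α+2)| ≤ C θ^(1/α), where (2i)^(α+2) is the principal-branch complex power and Γ is the Gamma function. -/
open MeasureTheory Set Filter Topology

noncomputable section

/-- The wave speed profile `c(x) = (1 + θ (x₊)^α)^(-1/2)`. -/
def spd (α θ x : ℝ) : ℝ := (1 + θ * (max x 0) ^ α) ^ (-(1 / 2) : ℝ)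

/-- The WKB amplitude `b(x) = c(x)^(1/2)`. -/
def amp (α θ x : ℝ) : ℝ := spd α θ x ^ ((1 : ℝ) / 2)

/-- The WKB phase `φ(x) = ∫₀ˣ c(y)⁻¹ dy`. -/
def phase (α θ x : ℝ) : ℝ := ∫ y in (0:ℝ)..x, (spd α θ y)⁻¹

/-- `M(x) = c(x)^(1/2) (c^(1/2))''(x)` for `x > 0`, and `0` for `x ≤ 0`. -/
def Mfun (α θ x : ℝ) : ℝ :=
  if 0 < x then
    spd α θ x ^ ((1 : ℝ) / 2) * deriv (deriv (fun y => spd α θ y ^ ((1 : ℝ) / 2))) x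
  else 0

/-- `M_{x₀} = ∫_{x₀}^∞ |M(x)| dx`. -/
def Mtail (α θ x₀ : ℝ) : ℝ := ∫ x in Ioi x₀, |Mfun α θ x|

/-- The Volterra operator `K_σ`. -/
def Kop (α θ x₀ σ : ℝ) (f : ℝ → ℂ) (x : ℝ) : ℂ :=
  (2 * Complex.I * (1 + Complex.I * (σ : ℂ)))⁻¹ *
    ((∫ y in x₀..x, (Mfun α θ y : ℂ) * f y *
        Complex.exp (-2 * Complex.I * (1 + Complex.I * (σ : ℂ)) *
          ((phase α θ x - phase α θ y : ℝ) : ℂ))) +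
      ∫ y in Ioi x, (Mfun α θ y : ℂ) * f y)

/-- The right-going WKB wave `v^> = b e^{-iφ}`. -/
def vplus (α θ x : ℝ) : ℂ := (amp α θ x : ℂ) * Complex.exp (-Complex.I * (phase α θ x : ℂ))

/-- The left-going WKB wave `v^< = b e^{iφ}`. -/
def vminus (α θ x : ℝ) : ℂ := (amp α θ x : ℂ) * Complex.exp (Complex.I * (phase α θ x : ℂ))

/-- `S` is a bounded continuous solution on `[x₀,∞)` of `S = e^{-2iφ} + K₀ S`. -/
def IsVolterraSol (α θ x₀ : ℝ) (S : ℝ → ℂ) : Prop :=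
  (∃ C, ∀ x ∈ Ici x₀, ‖S x‖ ≤ C) ∧ ContinuousOn S (Ici x₀) ∧
    ∀ x ∈ Ici x₀, S x = Complex.exp (-2 * Complex.I * (phase α θ x : ℂ)) + Kop α θ x₀ 0 S x

/-- `R_{x₀} = (2i)⁻¹ ∫_{x₀}^∞ M S^>`. -/
def Rx (α θ x₀ : ℝ) (S : ℝ → ℂ) : ℂ :=
  (2 * Complex.I)⁻¹ * ∫ x in Ioi x₀, (Mfun α θ x : ℂ) * S x

namespace WKB

/-- An open convex sector around the positive real axis, thin above and thicker below it. -/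
def sector (α : ℝ) : Set ℂ := {z | -z.re < α * z.im ∧ 2 * α ^ 2 * z.im < z.re}

/-- The direction of steepest descent used for contour integrals, pointing below the real axis. -/
def dir (α : ℝ) : ℂ := ⟨1, -(1 / α)⟩

@[simp] lemma dir_re (α : ℝ) : (dir α).re = 1 := rfl

@[simp] lemma dir_im (α : ℝ) : (dir α).im = -(1 / α) := rfl

lemma isOpen_sector (α : ℝ) : IsOpen (sector α) := by
  have h1 : IsOpen {z : ℂ | -z.re < α * z.im} := isOpen_lt (by fun_prop) (by fun_prop)
  have h2 : IsOpen {z : ℂ | 2 * α ^ 2 * z.im < z.re} := isOpen_lt (by fun_prop) (by fun_prop)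
  exact h1.inter h2

lemma convex_sector (α : ℝ) : Convex ℝ (sector α) := by
  intro z hz w hw a b ha hb hab
  obtain ⟨h1, h2⟩ := hz
  obtain ⟨h3, h4⟩ := hw
  have key : ∀ p q : ℝ, 0 < p → 0 < q → 0 < a * p + b * q := by
    intro p q hp hq
    rcases ha.eq_or_lt with h | h
    · have : b = 1 := by linarith
      subst this; rw [← h]; linarith
    · have := mul_pos h hp
      have := mul_nonneg hb hq.le
      linarith
  constructor
  · have := key (z.re + α * z.im) (w.re + α * w.im) (by linarith) (by linarith)
    simp
    linarith
  · have := key (z.re - 2 * α ^ 2 * z.im) (w.re - 2 * α ^ 2 * w.im) (by linarith) (by linarith)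
    simp
    linarith

lemma re_pos_of_mem_sector {α : ℝ} (hα : 1 ≤ α) {z : ℂ} (hz : z ∈ sector α) : 0 < z.re := by
  obtain ⟨h1, h2⟩ := hz
  by_contra! h
  have h3 : 0 < α * z.im := by linarith
  have h4 : 2 * α ^ 2 * z.im = 2 * α * (α * z.im) := by ring
  have h5 : 0 < 2 * α * (α * z.im) := by positivity
  linarith

lemma ofReal_mem_sector {α x : ℝ} (hx : 0 < x) : (x : ℂ) ∈ sector α := by
  constructor <;> simp [hx]

lemma add_dir_mem_sector {α : ℝ} (hα : 1 ≤ α) {z : ℂ} (hz : z ∈ sector α) {τ : ℝ} (hτ : 0 ≤ τ) :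
    z + τ * dir α ∈ sector α := by
  obtain ⟨h1, h2⟩ := hz
  have hα0 : α ≠ 0 := by positivity
  constructor
  · simp only [Complex.add_re, Complex.add_im, Complex.re_ofReal_mul, Complex.im_ofReal_mul,
      dir_re, dir_im]
    field_simp
    linarith
  · simp only [Complex.add_re, Complex.add_im, Complex.re_ofReal_mul, Complex.im_ofReal_mul,
      dir_re, dir_im]
    have : 2 * α ^ 2 * (z.im + τ * -(1 / α)) = 2 * α ^ 2 * z.im - 2 * α * τ := by
      field_simp
      ring
    rw [this]
    have : 0 ≤ α * τ := by positivity
    linarith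

lemma norm_dir_le {α : ℝ} (hα : 1 ≤ α) : ‖dir α‖ ≤ 2 := by
  have h := Complex.norm_le_abs_re_add_abs_im (dir α)
  have : |(dir α).im| ≤ 1 := by
    rw [dir_im, abs_neg, abs_of_nonneg (by positivity)]
    exact (div_le_one (by positivity)).2 hα
  simp only [dir_re, abs_one] at h
  linarith

lemma norm_le_two_mul_re {α : ℝ} (hα : 1 ≤ α) {z : ℂ} (hz : z ∈ sector α) : ‖z‖ ≤ 2 * z.re := by
  have h0 := re_pos_of_mem_sector hα hz
  have h := Complex.norm_le_abs_re_add_abs_im z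
  have : |z.im| ≤ z.re := by
    obtain ⟨h1, h2⟩ := hz
    rw [abs_le]
    constructor
    · by_contra! h
      nlinarith
    · by_contra! h
      nlinarith
  rw [abs_of_pos h0] at h
  linarith

lemma hasDerivAt_add_dir (α : ℝ) (z : ℂ) (τ : ℝ) :
    HasDerivAt (fun t : ℝ => z + t * dir α) (dir α) τ := by
  have := ((Complex.ofRealCLM.hasDerivAt (x := τ)).mul_const (dir α)).const_add z
  simpa using this

lemma integrableOn_add_rpow_neg_two {x : ℝ} (hx : 0 < x) :
    IntegrableOn (fun τ : ℝ => (x + τ) ^ (-2 : ℝ)) (Ioi 0) := by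
  have := integrableOn_add_rpow_Ioi_of_lt (a := -2) (c := 0) (m := x) (by norm_num) (by linarith)
  simpa [add_comm] using this

lemma integral_add_rpow_neg_two {x : ℝ} (hx : 0 < x) :
    ∫ τ in Ioi (0 : ℝ), (x + τ) ^ (-2 : ℝ) = x⁻¹ := by
  have h := integral_Ioi_rpow_of_lt (a := -2) (by norm_num) hx
  have h2 := (measurePreserving_add_left volume x).setIntegral_preimage_emb
    (measurableEmbedding_addLeft x) (fun t => t ^ (-2 : ℝ)) (Ioi x)
  have h3 : (fun y => x + y) ⁻¹' Ioi x = Ioi 0 := by ext; simp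
  rw [h3] at h2
  rw [h2, h]
  norm_num
  rw [Real.rpow_neg_one]

lemma continuousOn_comp_add_dir {α : ℝ} (hα : 1 ≤ α) {g : ℂ → ℂ} (hg : ContinuousOn g (sector α))
    {z : ℂ} (hz : z ∈ sector α) : ContinuousOn (fun τ : ℝ => g (z + τ * dir α)) (Ici 0) :=
  hg.comp (by fun_prop) fun _ hτ => add_dir_mem_sector hα hz hτ

/-- Integrals over rays with decaying holomorphic integrand are holomorphic in the base point. -/
lemma hasDerivAt_tail {α : ℝ} (hα : 1 ≤ α) {g : ℂ → ℂ} {h : ℂ → ℝ}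
    (hg : DifferentiableOn ℂ g (sector α)) (hh : ContinuousOn h (sector α))
    (hb : ∀ z ∈ sector α, ∀ τ : ℝ, 0 ≤ τ → ‖g (z + τ * dir α)‖ ≤ h z * (z.re + τ) ^ (-2 : ℝ))
    {z : ℂ} (hz : z ∈ sector α) :
    HasDerivAt (fun w => ∫ τ in Ioi (0 : ℝ), g (w + τ * dir α) * dir α) (-g z) z := by
  have hre := re_pos_of_mem_sector hα hz
  have hO := isOpen_sector α
  obtain ⟨ε₁, hε₁, hball⟩ := Metric.isOpen_iff.1 hO z hz
  obtain ⟨ε₂, hε₂, hball2⟩ := Metric.mem_nhds_iff.1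
    ((hh.continuousAt (hO.mem_nhds hz)).eventually (gt_mem_nhds (lt_add_one (h z))))
  set ε := min (min ε₁ ε₂) z.re / 3 with hε
  have hm : 0 < min (min ε₁ ε₂) z.re := by positivity
  have hεp : 0 < ε := by positivity
  have h1 : 3 * ε ≤ ε₁ := by
    have : 3 * ε = min (min ε₁ ε₂) z.re := by rw [hε]; ring
    rw [this]; exact (min_le_left _ _).trans (min_le_left _ _)
  have h2 : 3 * ε ≤ ε₂ := by
    have : 3 * ε = min (min ε₁ ε₂) z.re := by rw [hε]; ring
    rw [this]; exact (min_le_left _ _).trans (min_le_right _ _)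
  have h3 : 3 * ε ≤ z.re := by
    have : 3 * ε = min (min ε₁ ε₂) z.re := by rw [hε]; ring
    rw [this]; exact min_le_right _ _
  set H := |h z| + 1
  have hH : 0 < H := by positivity
  have hbd : ∀ w ∈ Metric.ball z (3 * ε), ∀ τ : ℝ, 0 ≤ τ → w ∈ sector α ∧
      ‖g (w + τ * dir α)‖ ≤ H * (w.re + τ) ^ (-2 : ℝ) := by
    intro w hw τ hτ
    have hwO : w ∈ sector α := hball (Metric.ball_subset_ball h1 hw)
    refine ⟨hwO, (hb w hwO τ hτ).trans ?_⟩
    have := hball2 (Metric.ball_subset_ball h2 hw)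
    simp only [mem_ofPred_eq] at this
    have hr := re_pos_of_mem_sector hα hwO
    gcongr
    have := le_abs_self (h z)
    linarith
  have hre_ball : ∀ w ∈ Metric.ball z (2 * ε), ε < w.re := by
    intro w hw
    have h5 := Complex.abs_re_le_norm (z - w)
    rw [← dist_eq_norm, dist_comm] at h5
    have h6 := le_abs_self (z - w).re
    rw [Metric.mem_ball] at hw
    simp only [Complex.sub_re] at h5 h6
    linarith
  have hmeas : ∀ w ∈ sector α, AEStronglyMeasurable (fun τ : ℝ => g (w + τ * dir α) * dir α)
      (volume.restrict (Ioi 0)) := by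
    intro w hw
    exact (((continuousOn_comp_add_dir hα hg.continuousOn hw).mono
      Ioi_subset_Ici_self).mul continuousOn_const).aestronglyMeasurable measurableSet_Ioi
  have hdg : DifferentiableOn ℂ (deriv g) (sector α) := hg.deriv hO
  have hint : IntegrableOn (fun τ : ℝ => g (z + τ * dir α) * dir α) (Ioi 0) := by
    refine Integrable.mono' (((integrableOn_add_rpow_neg_two hre).const_mul (H)).mul_const
      ‖dir α‖) (hmeas z hz) ?_
    refine (ae_restrict_iff' measurableSet_Ioi).2 (Eventually.of_forall fun τ hτ => ?_)
    rw [norm_mul]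
    gcongr
    exact (hbd z (Metric.mem_ball_self (by positivity)) τ (mem_Ioi.1 hτ).le).2
  have main := hasDerivAt_integral_of_dominated_loc_of_deriv_le (𝕜 := ℂ)
    (μ := volume.restrict (Ioi (0 : ℝ))) (x₀ := z) (s := Metric.ball z ε)
    (F := fun w (τ : ℝ) => g (w + τ * dir α) * dir α)
    (F' := fun w (τ : ℝ) => deriv g (w + τ * dir α) * dir α)
    (bound := fun τ : ℝ => H * (ε + τ) ^ (-2 : ℝ) / ε * ‖dir α‖)
    (Metric.ball_mem_nhds z hεp)
    (by filter_upwards [hO.mem_nhds hz] with w hw using hmeas w hw)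
    hint
    ((((continuousOn_comp_add_dir hα hdg.continuousOn hz).mono
      Ioi_subset_Ici_self).mul continuousOn_const).aestronglyMeasurable measurableSet_Ioi)
    (by
      refine (ae_restrict_iff' measurableSet_Ioi).2 (Eventually.of_forall fun τ hτ w hw => ?_)
      have hτ0 : 0 ≤ τ := (mem_Ioi.1 hτ).le
      rw [norm_mul]
      gcongr
      have hsub : ∀ v ∈ Metric.closedBall (w + τ * dir α) ε,
          v - τ * dir α ∈ Metric.ball z (2 * ε) := by
        intro v hv
        rw [Metric.mem_closedBall, dist_eq_norm] at hv
        rw [Metric.mem_ball, dist_eq_norm] at hw ⊢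
        calc ‖v - τ * dir α - z‖ = ‖(v - (w + τ * dir α)) + (w - z)‖ := by congr 1; ring
          _ ≤ _ := norm_add_le _ _
          _ < 2 * ε := by linarith
      have h2to3 : Metric.ball z (2 * ε) ⊆ Metric.ball z (3 * ε) :=
        Metric.ball_subset_ball (by linarith)
      refine Complex.norm_deriv_le_of_forall_mem_sphere_norm_le hεp ?_ ?_
      · refine (hg.mono ?_).diffContOnCl
        rw [closure_ball _ hεp.ne']
        intro v hv
        have := add_dir_mem_sector hα (hbd _ (h2to3 (hsub v hv)) τ hτ0).1 hτ0
        simpa using this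
      · intro v hv
        have hv' := hsub v (Metric.sphere_subset_closedBall hv)
        have := (hbd _ (h2to3 hv') τ hτ0).2
        rw [sub_add_cancel] at this
        refine this.trans ?_
        have := hre_ball _ hv'
        gcongr ?_ * ?_
        exact Real.rpow_le_rpow_of_nonpos (by linarith) (by linarith) (by norm_num))
    ((((integrableOn_add_rpow_neg_two hεp).const_mul H).div_const ε).mul_const ‖dir α‖)
    (by
      refine (ae_restrict_iff' measurableSet_Ioi).2 (Eventually.of_forall fun τ hτ w hw => ?_)
      have hwO : w ∈ sector α := hball (Metric.ball_subset_ball (by linarith) hw)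
      have hmem := add_dir_mem_sector hα hwO (mem_Ioi.1 hτ).le
      have hd := (hg.differentiableAt (hO.mem_nhds hmem)).hasDerivAt
      exact (hd.comp_add_const w _).mul_const _)
  have hval : ∫ τ in Ioi (0 : ℝ), deriv g (z + τ * dir α) * dir α = 0 - g (z + (0 : ℝ) * dir α) := by
    refine integral_Ioi_of_hasDerivAt_of_tendsto' (f := fun τ : ℝ => g (z + τ * dir α)) ?_ main.1 ?_
    · intro τ hτ
      have hmem := add_dir_mem_sector hα hz hτ
      have hd := (hg.differentiableAt (hO.mem_nhds hmem)).hasDerivAt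
      exact hd.comp τ (hasDerivAt_add_dir α z τ)
    · refine squeeze_zero_norm' (a := fun τ : ℝ => h z * (z.re + τ) ^ (-2 : ℝ)) ?_ ?_
      · filter_upwards [eventually_ge_atTop 0] with τ hτ using hb z hz τ hτ
      · have : Tendsto (fun τ : ℝ => (z.re + τ) ^ (-2 : ℝ)) atTop (𝓝 0) :=
          (tendsto_rpow_neg_atTop (by norm_num : (0 : ℝ) < 2)).comp
            (tendsto_atTop_add_const_left _ _ tendsto_id)
        simpa using this.const_mul (h z)
  have := main.2
  rw [hval] at this
  simpa using this

/-- Holomorphic functions on convex open sets have primitives. -/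
lemma exists_primitive_of_convex {U : Set ℂ} (hO : IsOpen U) (hU : Convex ℝ U) {c : ℂ} (hc : c ∈ U)
    {f : ℂ → ℂ} (hf : DifferentiableOn ℂ f U) : ∃ F : ℂ → ℂ, ∀ z ∈ U, HasDerivAt F (f z) z := by
  refine ⟨fun z => (z - c) * ∫ t in (0 : ℝ)..1, f (c + t * (z - c)), fun z hz => ?_⟩
  have hseg : ∀ w ∈ U, ∀ t ∈ Icc (0 : ℝ) 1, c + t * (w - c) ∈ U := by
    intro w hw t ht
    have := hU hc hw (sub_nonneg.2 ht.2) ht.1 (by ring)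
    convert this using 1
    simp [Complex.real_smul]
    ring
  have hdf : DifferentiableOn ℂ (deriv f) U := hf.deriv hO
  have hcomp : ∀ {g : ℂ → ℂ}, ContinuousOn g U → ∀ w ∈ U,
      ContinuousOn (fun t : ℝ => g (c + t * (w - c))) (Icc 0 1) := fun hg w hw =>
    hg.comp (by fun_prop) fun t ht => hseg w hw t ht
  obtain ⟨ε, hε, hball⟩ := Metric.nhds_basis_closedBall.mem_iff.1 (hO.mem_nhds hz)
  obtain ⟨C, hC⟩ := ((isCompact_Icc (a := (0 : ℝ)) (b := 1)).prod
    (isCompact_closedBall z ε)).exists_bound_of_continuousOn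
    (f := fun p : ℝ × ℂ => deriv f (c + p.1 * (p.2 - c)))
    (hdf.continuousOn.comp (by fun_prop) fun p hp => hseg p.2 (hball hp.2) p.1 hp.1)
  have hIoc : uIoc (0 : ℝ) 1 ⊆ Icc 0 1 := by
    rw [uIoc_of_le zero_le_one]; exact Ioc_subset_Icc_self
  have main := intervalIntegral.hasDerivAt_integral_of_dominated_loc_of_deriv_le (𝕜 := ℂ)
    (μ := volume) (a := 0) (b := 1) (x₀ := z) (s := Metric.ball z ε)
    (F := fun w (t : ℝ) => f (c + t * (w - c)))
    (F' := fun w (t : ℝ) => deriv f (c + t * (w - c)) * t) (bound := fun _ => C)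
    (Metric.ball_mem_nhds z hε)
    (by
      filter_upwards [hO.mem_nhds hz] with w hw
      exact ((hcomp hf.continuousOn w hw).mono hIoc).aestronglyMeasurable measurableSet_uIoc)
    ((hcomp hf.continuousOn z hz).intervalIntegrable_of_Icc zero_le_one)
    (((hcomp hdf.continuousOn z hz).mul (by fun_prop)).mono hIoc
      |>.aestronglyMeasurable measurableSet_uIoc)
    (by
      refine Eventually.of_forall fun t ht w hw => ?_
      have ht' := hIoc ht
      have h1 := hC (t, w) ⟨ht', Metric.ball_subset_closedBall hw⟩
      simp only at h1
      rw [norm_mul, Complex.norm_real, Real.norm_of_nonneg ht'.1]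
      calc _ ≤ ‖deriv f (c + t * (w - c))‖ * 1 := by gcongr; exact ht'.2
        _ ≤ C := by rwa [mul_one])
    intervalIntegrable_const
    (by
      refine Eventually.of_forall fun t ht w hw => ?_
      have hmem := hseg w (hball (Metric.ball_subset_closedBall hw)) t (hIoc ht)
      have hd := (hf.differentiableAt (hO.mem_nhds hmem)).hasDerivAt
      have hin : HasDerivAt (fun w : ℂ => c + t * (w - c)) (t : ℂ) w := by
        simpa using (((hasDerivAt_id w).sub_const c).const_mul (t : ℂ)).const_add c
      exact hd.comp w hin)
  have hF := ((hasDerivAt_id z).sub_const c).mul main.2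
  have hftc : ∫ t in (0 : ℝ)..1,
      (f (c + t * (z - c)) + (z - c) * (deriv f (c + t * (z - c)) * t)) = f z := by
    have := intervalIntegral.integral_eq_sub_of_hasDerivAt (a := 0) (b := 1)
      (f := fun t : ℝ => (t : ℂ) * f (c + t * (z - c)))
      (f' := fun t : ℝ => f (c + t * (z - c)) + (z - c) * (deriv f (c + t * (z - c)) * t))
      (by
        intro t ht
        rw [uIcc_of_le zero_le_one] at ht
        have hd := (hf.differentiableAt (hO.mem_nhds (hseg z hz t ht))).hasDerivAt
        have hin : HasDerivAt (fun t : ℝ => c + (t : ℂ) * (z - c)) (z - c) t := by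
          simpa using ((Complex.ofRealCLM.hasDerivAt (x := t)).mul_const (z - c)).const_add c
        have := (Complex.ofRealCLM.hasDerivAt (x := t)).mul (hd.comp t hin)
        refine this.congr_deriv ?_
        simp
        ring)
      (((hcomp hf.continuousOn z hz).intervalIntegrable_of_Icc zero_le_one).add
        (main.1.const_mul _))
    rw [this]
    simp
  rw [intervalIntegral.integral_add
    ((hcomp hf.continuousOn z hz).intervalIntegrable_of_Icc zero_le_one) (main.1.const_mul _),
    intervalIntegral.integral_const_mul] at hftc
  refine hF.congr_deriv ?_
  rw [← hftc]
  simp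

section Sector

variable {α : ℝ} {z : ℂ}

lemma ne_zero_of_mem_sector (hα : 1 ≤ α) (hz : z ∈ sector α) : z ≠ 0 := by
  rintro rfl
  simpa using re_pos_of_mem_sector hα hz

lemma mem_slitPlane_of_mem_sector (hα : 1 ≤ α) (hz : z ∈ sector α) : z ∈ Complex.slitPlane :=
  Or.inl (re_pos_of_mem_sector hα hz)

lemma arg_bounds_of_mem_sector (hα : 1 ≤ α) (hz : z ∈ sector α) :
    -1 < z.arg * α ∧ z.arg * α ≤ 1 / (2 * α) := by
  have h0 := re_pos_of_mem_sector hα hz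
  have hα0 : 0 < α := by linarith
  obtain ⟨h1, h2⟩ := hz
  have habs := Complex.abs_arg_lt_pi_div_two_iff.2 (Or.inl h0)
  rw [abs_lt] at habs
  have htan := Complex.tan_arg z
  have hpos : 0 < 1 / (2 * α) := by positivity
  rcases le_or_gt 0 z.arg with h | h
  · constructor
    · nlinarith
    · have h3 := Real.le_tan h habs.2
      rw [htan, le_div_iff₀ h0] at h3
      rw [le_div_iff₀ (by positivity)]
      have : z.arg * α * (2 * α) * z.re < 1 * z.re := by nlinarith
      exact (lt_of_mul_lt_mul_right this h0.le).le
  · constructor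
    · have h3 := Real.le_tan (x := -z.arg) (by linarith) (by linarith)
      rw [Real.tan_neg, htan] at h3
      have h4 : -z.arg * z.re ≤ - z.im := by
        have := mul_le_mul_of_nonneg_right h3 h0.le
        rwa [neg_mul (z.im / z.re), div_mul_cancel₀ _ h0.ne'] at this
      have : (-1) * z.re < z.arg * α * z.re := by nlinarith
      exact lt_of_mul_lt_mul_right this h0.le
    · nlinarith

lemma half_le_re_cpow (hα : 1 ≤ α) (hz : z ∈ sector α) :
    ‖z‖ ^ α / 2 ≤ (z ^ (α : ℂ)).re := by
  obtain ⟨h1, h2⟩ := arg_bounds_of_mem_sector hα hz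
  have h3 : 1 / (2 * α) ≤ 1 := by
    rw [div_le_one (by positivity)]; linarith
  rw [Complex.cpow_ofReal_re]
  have hcos : 1 / 2 ≤ Real.cos (z.arg * α) := by
    have := Real.one_sub_sq_div_two_le_cos (x := z.arg * α)
    nlinarith
  have : 0 ≤ ‖z‖ ^ α := by positivity
  nlinarith

lemma im_cpow_le (hα : 1 ≤ α) (hz : z ∈ sector α) :
    (z ^ (α : ℂ)).im ≤ ‖z‖ ^ α / (2 * α) := by
  obtain ⟨h1, h2⟩ := arg_bounds_of_mem_sector hα hz
  have h4 : 0 < 1 / (2 * α) := by positivity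
  rw [Complex.cpow_ofReal_im]
  have hsin : Real.sin (z.arg * α) ≤ 1 / (2 * α) := by
    rcases le_or_gt 0 (z.arg * α) with h | h
    · exact (Real.sin_le h).trans h2
    · have := Real.sin_nonpos_of_nonpos_of_neg_pi_le h.le (by linarith [Real.pi_gt_three])
      linarith
  have : 0 ≤ ‖z‖ ^ α := by positivity
  calc _ ≤ ‖z‖ ^ α * (1 / (2 * α)) := by gcongr
    _ = _ := by ring

end Sector

/-- The holomorphic extension of `c⁻²`. -/
def qC (α θ : ℝ) (z : ℂ) : ℂ := 1 + θ * z ^ (α : ℂ)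

/-- The derivative of `qC`. -/
def qC' (α θ : ℝ) (z : ℂ) : ℂ := θ * (α * z ^ ((α : ℂ) - 1))

/-- The second derivative of `qC`. -/
def qC'' (α θ : ℝ) (z : ℂ) : ℂ := θ * (α * ((α - 1) * z ^ ((α : ℂ) - 1 - 1)))

/-- The holomorphic extension of the WKB amplitude. -/
def bC (α θ : ℝ) (z : ℂ) : ℂ := qC α θ z ^ ((-(1 / 4) : ℝ) : ℂ)

/-- The derivative of `bC`. -/
def bC' (α θ : ℝ) (z : ℂ) : ℂ := -(1 / 4) * (qC' α θ z * bC α θ z / qC α θ z)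

/-- The holomorphic extension of `M`. -/
def MC (α θ : ℝ) (z : ℂ) : ℂ :=
  bC α θ z ^ 2 * (-(1 / 4) * (qC'' α θ z / qC α θ z) + 5 / 16 * (qC' α θ z / qC α θ z) ^ 2)

/-- The holomorphic extension of `c⁻¹`. -/
def sC (α θ : ℝ) (z : ℂ) : ℂ := (bC α θ z ^ 2)⁻¹

section Coefficients

variable {α θ : ℝ} {z : ℂ}

lemma re_qC_ge (hα : 1 ≤ α) (hθ : 0 < θ) (hz : z ∈ sector α) :
    1 + θ * ‖z‖ ^ α / 2 ≤ (qC α θ z).re := by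
  have := half_le_re_cpow hα hz
  simp only [qC, Complex.add_re, Complex.one_re, Complex.re_ofReal_mul]
  nlinarith

lemma one_le_re_qC (hα : 1 ≤ α) (hθ : 0 < θ) (hz : z ∈ sector α) : 1 ≤ (qC α θ z).re := by
  have h : 0 ≤ θ * ‖z‖ ^ α / 2 := by positivity
  linarith [re_qC_ge hα hθ hz]

lemma one_le_norm_qC (hα : 1 ≤ α) (hθ : 0 < θ) (hz : z ∈ sector α) : 1 ≤ ‖qC α θ z‖ :=
  (one_le_re_qC hα hθ hz).trans (Complex.re_le_norm _)

lemma half_le_norm_qC (hα : 1 ≤ α) (hθ : 0 < θ) (hz : z ∈ sector α) :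
    θ * ‖z‖ ^ α / 2 ≤ ‖qC α θ z‖ := by
  linarith [re_qC_ge hα hθ hz, Complex.re_le_norm (qC α θ z)]

lemma qC_ne_zero (hα : 1 ≤ α) (hθ : 0 < θ) (hz : z ∈ sector α) : qC α θ z ≠ 0 := by
  rw [← norm_pos_iff]
  linarith [one_le_norm_qC hα hθ hz]

lemma bC_ne_zero (hα : 1 ≤ α) (hθ : 0 < θ) (hz : z ∈ sector α) : bC α θ z ≠ 0 := by
  rw [bC, Complex.cpow_def_of_ne_zero (qC_ne_zero hα hθ hz)]
  exact Complex.exp_ne_zero _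

lemma bC_pow_four : bC α θ z ^ 4 = (qC α θ z)⁻¹ := by
  rw [bC, ← Complex.cpow_nat_mul, ← Complex.cpow_neg_one]
  norm_num

lemma norm_bC_le (hα : 1 ≤ α) (hθ : 0 < θ) (hz : z ∈ sector α) : ‖bC α θ z‖ ≤ 1 := by
  rw [bC, Complex.norm_cpow_real]
  exact Real.rpow_le_one_of_one_le_of_nonpos (one_le_norm_qC hα hθ hz) (by norm_num)

lemma abs_arg_qC_lt (hα : 1 ≤ α) (hθ : 0 < θ) (hz : z ∈ sector α) :
    |(qC α θ z).arg| < Real.pi / 2 :=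
  Complex.abs_arg_lt_pi_div_two_iff.2 (Or.inl (by linarith [one_le_re_qC hα hθ hz]))

lemma re_bC_pos (hα : 1 ≤ α) (hθ : 0 < θ) (hz : z ∈ sector α) : 0 < (bC α θ z).re := by
  have harg := abs_lt.1 (abs_arg_qC_lt hα hθ hz)
  rw [bC, Complex.cpow_ofReal_re]
  have h1 : 0 < ‖qC α θ z‖ := by linarith [one_le_norm_qC hα hθ hz]
  have h2 : 0 < Real.cos ((qC α θ z).arg * -(1 / 4)) :=
    Real.cos_pos_of_mem_Ioo ⟨by linarith, by linarith⟩
  positivity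

lemma sC_eq : sC α θ z = qC α θ z ^ ((1 / 2 : ℝ) : ℂ) := by
  rw [sC, bC, ← Complex.cpow_nat_mul, ← Complex.cpow_neg]
  norm_num

lemma sC_sq : sC α θ z ^ 2 = qC α θ z := by
  rw [sC, inv_pow, ← pow_mul, bC_pow_four, inv_inv]

lemma re_sC_pos (hα : 1 ≤ α) (hθ : 0 < θ) (hz : z ∈ sector α) : 0 < (sC α θ z).re := by
  have harg := abs_lt.1 (abs_arg_qC_lt hα hθ hz)
  rw [sC_eq, Complex.cpow_ofReal_re]
  have h1 : 0 < ‖qC α θ z‖ := by linarith [one_le_norm_qC hα hθ hz]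
  have h2 : 0 < Real.cos ((qC α θ z).arg * (1 / 2)) :=
    Real.cos_pos_of_mem_Ioo ⟨by linarith, by linarith⟩
  positivity

lemma re_sC_sq (hα : 1 ≤ α) (hθ : 0 < θ) (hz : z ∈ sector α) :
    1 + θ * ‖z‖ ^ α / 2 ≤ (sC α θ z).re ^ 2 := by
  have h := congrArg Complex.re (sC_sq (α := α) (θ := θ) (z := z))
  rw [pow_two, Complex.mul_re] at h
  nlinarith [re_qC_ge hα hθ hz, sq_nonneg (sC α θ z).im]

lemma one_le_re_sC (hα : 1 ≤ α) (hθ : 0 < θ) (hz : z ∈ sector α) : 1 ≤ (sC α θ z).re := by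
  have h1 := re_sC_pos hα hθ hz
  have h2 := re_sC_sq hα hθ hz
  have h : 0 ≤ θ * ‖z‖ ^ α / 2 := by positivity
  nlinarith

lemma im_sC_mul_dir_le (hα : 1 ≤ α) (hθ : 0 < θ) (hz : z ∈ sector α) :
    (sC α θ z * dir α).im ≤ -(1 / (2 * α)) := by
  have hα0 : 0 < α := by linarith
  have h1 := one_le_re_sC hα hθ hz
  have h2 := re_sC_sq hα hθ hz
  have h3 := im_cpow_le hα hz
  have h4 := congrArg Complex.im (sC_sq (α := α) (θ := θ) (z := z))
  simp only [pow_two, Complex.mul_im, qC, Complex.add_im, Complex.one_im,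
    Complex.ofReal_re, Complex.ofReal_im, zero_mul, add_zero, zero_add] at h4
  rw [Complex.mul_im, dir_re, dir_im]
  set x := (sC α θ z).re
  set y := (sC α θ z).im
  set Y := ‖z‖ ^ α
  have h5 : 2 * x * y ≤ θ * (Y / (2 * α)) := by nlinarith
  have h6 : y ≤ x / (2 * α) := by
    have : θ * (Y / (2 * α)) ≤ x ^ 2 / α := by
      have : θ * (Y / (2 * α)) = (θ * Y / 2) / α := by field_simp
      rw [this]
      gcongr
      linarith
    have h7 : x * y ≤ x * (x / (2 * α)) := by
      have : x * (x / (2 * α)) = x ^ 2 / α / 2 := by field_simp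
      linarith
    exact le_of_mul_le_mul_left h7 (by linarith)
  have h8 : 1 / (2 * α) ≤ x / (2 * α) := by gcongr
  have h9 : x * -(1 / α) + y * 1 ≤ -(x / (2 * α)) := by
    have : x * -(1 / α) = - (x / (2 * α)) - x / (2 * α) := by field_simp; ring
    linarith
  linarith

lemma norm_sC_sub_one_le (hα : 1 ≤ α) (hθ : 0 < θ) (hz : z ∈ sector α) :
    ‖sC α θ z - 1‖ ≤ θ * ‖z‖ ^ α := by
  have h1 := one_le_re_sC hα hθ hz
  have h2 : (sC α θ z - 1) * (sC α θ z + 1) = θ * z ^ (α : ℂ) := by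
    have := sC_sq (α := α) (θ := θ) (z := z)
    rw [qC] at this
    linear_combination this
  have h3 := congrArg norm h2
  rw [norm_mul, norm_mul, Complex.norm_real, Real.norm_of_nonneg hθ.le,
    Complex.norm_cpow_real] at h3
  have h4 : 1 ≤ ‖sC α θ z + 1‖ := by
    have := Complex.re_le_norm (sC α θ z + 1)
    simp only [Complex.add_re, Complex.one_re] at this
    linarith
  nlinarith [norm_nonneg (sC α θ z - 1)]

lemma norm_bC_sub_one_le (hα : 1 ≤ α) (hθ : 0 < θ) (hz : z ∈ sector α) :
    ‖bC α θ z - 1‖ ≤ θ * ‖z‖ ^ α := by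
  have hb := norm_bC_le hα hθ hz
  have h0 := bC_ne_zero hα hθ hz
  have h2 : (bC α θ z - 1) * (bC α θ z + 1) = -(bC α θ z ^ 2 * (sC α θ z - 1)) := by
    rw [sC]; field_simp; ring
  have h3 := congrArg norm h2
  rw [norm_mul, norm_neg, norm_mul, norm_pow] at h3
  have h4 : 1 ≤ ‖bC α θ z + 1‖ := by
    have := Complex.re_le_norm (bC α θ z + 1)
    have h5 := re_bC_pos hα hθ hz
    simp only [Complex.add_re, Complex.one_re] at this
    linarith
  have h6 := norm_sC_sub_one_le hα hθ hz
  have h7 : ‖bC α θ z‖ ^ 2 ≤ 1 := pow_le_one₀ (norm_nonneg _) hb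
  nlinarith [norm_nonneg (bC α θ z - 1), norm_nonneg (sC α θ z - 1)]

lemma hasDerivAt_qC (hα : 1 ≤ α) (hz : z ∈ sector α) :
    HasDerivAt (qC α θ) (qC' α θ z) z := by
  have := (((hasDerivAt_id z).cpow_const (c := (α : ℂ))
    (mem_slitPlane_of_mem_sector hα hz)).const_mul (θ : ℂ)).const_add 1
  refine this.congr_deriv ?_
  simp [qC']

lemma hasDerivAt_qC' (hα : 1 ≤ α) (hz : z ∈ sector α) :
    HasDerivAt (qC' α θ) (qC'' α θ z) z := by
  have := (((hasDerivAt_id z).cpow_const (c := (α : ℂ) - 1)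
    (mem_slitPlane_of_mem_sector hα hz)).const_mul (α : ℂ)).const_mul (θ : ℂ)
  refine this.congr_deriv ?_
  simp [qC'']

lemma hasDerivAt_bC (hα : 1 ≤ α) (hθ : 0 < θ) (hz : z ∈ sector α) :
    HasDerivAt (bC α θ) (bC' α θ z) z := by
  have hq := qC_ne_zero hα hθ hz
  have := (hasDerivAt_qC (θ := θ) hα hz).cpow_const (c := ((-(1 / 4) : ℝ) : ℂ))
    (Or.inl (by linarith [one_le_re_qC hα hθ hz]))
  refine this.congr_deriv ?_
  rw [bC', bC, Complex.cpow_sub _ _ hq, Complex.cpow_one]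
  push_cast
  ring

lemma hasDerivAt_bC' (hα : 1 ≤ α) (hθ : 0 < θ) (hz : z ∈ sector α) :
    HasDerivAt (bC' α θ) (MC α θ z / bC α θ z) z := by
  have hq := qC_ne_zero hα hθ hz
  have hb := bC_ne_zero hα hθ hz
  have := ((((hasDerivAt_qC' (θ := θ) hα hz).mul (hasDerivAt_bC hα hθ hz)).div
    (hasDerivAt_qC hα hz) hq)).const_mul (-(1 / 4) : ℂ)
  refine this.congr_deriv ?_
  rw [MC, Pi.mul_apply, bC']
  field_simp
  ring

lemma norm_qC' (hα : 1 ≤ α) (hθ : 0 < θ) (hz : z ∈ sector α) :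
    ‖qC' α θ z‖ = α * (θ * ‖z‖ ^ α) / ‖z‖ := by
  have hz0 := ne_zero_of_mem_sector hα hz
  rw [qC', Complex.cpow_sub _ _ hz0, Complex.cpow_one]
  simp only [norm_mul, norm_div, Complex.norm_real, Complex.norm_cpow_real,
    Real.norm_of_nonneg hθ.le, Real.norm_of_nonneg (zero_le_one.trans hα)]
  ring

lemma norm_qC'' (hα : 1 ≤ α) (hθ : 0 < θ) (hz : z ∈ sector α) :
    ‖qC'' α θ z‖ = α * (α - 1) * (θ * ‖z‖ ^ α) / ‖z‖ ^ 2 := by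
  have hz0 := ne_zero_of_mem_sector hα hz
  rw [qC'', Complex.cpow_sub _ _ hz0, Complex.cpow_sub _ _ hz0, Complex.cpow_one]
  have : ((α : ℂ) - 1) = ((α - 1 : ℝ) : ℂ) := by push_cast; rfl
  rw [this]
  simp only [norm_mul, norm_div, Complex.norm_real, Complex.norm_cpow_real,
    Real.norm_of_nonneg hθ.le, Real.norm_of_nonneg (zero_le_one.trans hα),
    Real.norm_of_nonneg (sub_nonneg.2 hα)]
  ring

lemma norm_MC_le_aux (hα : 1 ≤ α) (hθ : 0 < θ) (hz : z ∈ sector α) {W : ℝ}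
    (h : θ * ‖z‖ ^ α ≤ W * ‖qC α θ z‖) :
    ‖MC α θ z‖ ≤ (1 / 4 * (α * (α - 1) * W) + 5 / 16 * (α * W) ^ 2) / ‖z‖ ^ 2 := by
  have hz0 : 0 < ‖z‖ := norm_pos_iff.2 (ne_zero_of_mem_sector hα hz)
  have hq : 0 < ‖qC α θ z‖ := by linarith [one_le_norm_qC hα hθ hz]
  have hb := norm_bC_le hα hθ hz
  have hα1 : 0 ≤ α - 1 := by linarith
  have h1 : ‖qC' α θ z / qC α θ z‖ ≤ α * W / ‖z‖ := by
    rw [norm_div, norm_qC' hα hθ hz, div_right_comm, div_le_div_iff_of_pos_right hz0,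
      div_le_iff₀ hq]
    nlinarith
  have h2 : ‖qC'' α θ z / qC α θ z‖ ≤ α * (α - 1) * W / ‖z‖ ^ 2 := by
    rw [norm_div, norm_qC'' hα hθ hz, div_right_comm,
      div_le_div_iff_of_pos_right (by positivity), div_le_iff₀ hq]
    have : 0 ≤ α * (α - 1) := by positivity
    nlinarith
  rw [MC, norm_mul, norm_pow]
  calc _ ≤ 1 * ‖-(1 / 4) * (qC'' α θ z / qC α θ z) + 5 / 16 * (qC' α θ z / qC α θ z) ^ 2‖ := by
        gcongr; exact pow_le_one₀ (norm_nonneg _) hb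
    _ ≤ 1 / 4 * (α * (α - 1) * W / ‖z‖ ^ 2) + 5 / 16 * (α * W / ‖z‖) ^ 2 := by
        rw [one_mul]
        refine (norm_add_le _ _).trans ?_
        have e1 : ‖(-(1 / 4) : ℂ)‖ = 1 / 4 := by norm_num
        have e2 : ‖(5 / 16 : ℂ)‖ = 5 / 16 := by norm_num
        rw [norm_mul, norm_mul, norm_pow, e1, e2]
        gcongr
    _ = _ := by field_simp

lemma norm_MC_le (hα : 1 ≤ α) (hθ : 0 < θ) (hz : z ∈ sector α) :
    ‖MC α θ z‖ ≤ 2 * α ^ 2 / ‖z‖ ^ 2 := by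
  refine (norm_MC_le_aux hα hθ hz (W := 2)
    (by linarith [half_le_norm_qC hα hθ hz])).trans ?_
  gcongr
  nlinarith

lemma norm_MC_le' (hα : 1 ≤ α) (hθ : 0 < θ) (hz : z ∈ sector α) :
    ‖MC α θ z‖ ≤ α ^ 2 * ((α - 1) * (θ * ‖z‖ ^ α) + (θ * ‖z‖ ^ α) ^ 2) / ‖z‖ ^ 2 := by
  have h0 : 0 ≤ θ * ‖z‖ ^ α := by positivity
  have h1 := one_le_norm_qC hα hθ hz
  refine (norm_MC_le_aux hα hθ hz (W := θ * ‖z‖ ^ α) (by nlinarith)).trans ?_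
  gcongr
  set Y := θ * ‖z‖ ^ α
  have h2 : 0 ≤ (α - 1) * Y := mul_nonneg (by linarith) h0
  nlinarith [sq_nonneg (α * Y), mul_nonneg (by linarith : (0:ℝ) ≤ α) h2,
    mul_nonneg (mul_nonneg (by linarith : (0:ℝ) ≤ α) (by linarith : (0 : ℝ) ≤ α - 1)) h2]

end Coefficients

section RealAxis

variable {α θ : ℝ} {x : ℝ}

lemma one_le_profile (hθ : 0 < θ) (x : ℝ) : 1 ≤ 1 + θ * (max x 0) ^ α := by
  have : 0 ≤ θ * (max x 0) ^ α := by positivity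
  linarith

lemma spd_pos (hθ : 0 < θ) (x : ℝ) : 0 < spd α θ x :=
  Real.rpow_pos_of_pos (by linarith [one_le_profile (α := α) hθ x]) _

lemma spd_eq_one (hα : 1 ≤ α) (hx : x ≤ 0) : spd α θ x = 1 := by
  rw [spd, max_eq_right hx, Real.zero_rpow (by linarith), mul_zero, add_zero, Real.one_rpow]

lemma continuous_spd (hα : 1 ≤ α) (hθ : 0 < θ) : Continuous (spd α θ) := by
  refine Continuous.rpow_const ?_ fun x => Or.inl (by linarith [one_le_profile (α := α) hθ x])
  exact (((continuous_id.max continuous_const).rpow_const fun x =>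
    Or.inr (by linarith)).const_mul θ).const_add 1

lemma hasDerivAt_phase (hα : 1 ≤ α) (hθ : 0 < θ) (x : ℝ) :
    HasDerivAt (phase α θ) (spd α θ x)⁻¹ x := by
  have hc : Continuous fun y => (spd α θ y)⁻¹ :=
    (continuous_spd hα hθ).inv₀ fun y => (spd_pos hθ y).ne'
  exact intervalIntegral.integral_hasDerivAt_right (hc.intervalIntegrable _ _)
    (hc.stronglyMeasurableAtFilter _ _) hc.continuousAt

lemma phase_zero : phase α θ 0 = 0 := by simp [phase]

lemma continuous_phase (hα : 1 ≤ α) (hθ : 0 < θ) : Continuous (phase α θ) :=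
  continuous_iff_continuousAt.2 fun x => (hasDerivAt_phase hα hθ x).continuousAt

lemma qC_ofReal (hx : 0 < x) : qC α θ x = ((1 + θ * (max x 0) ^ α : ℝ) : ℂ) := by
  rw [qC, max_eq_left hx.le]
  push_cast
  rw [Complex.ofReal_cpow hx.le]

lemma amp_eq (hθ : 0 < θ) (x : ℝ) : amp α θ x = (1 + θ * (max x 0) ^ α) ^ (-(1 / 4) : ℝ) := by
  rw [amp, spd, ← Real.rpow_mul (by linarith [one_le_profile (α := α) hθ x])]
  norm_num

lemma bC_ofReal (hθ : 0 < θ) (hx : 0 < x) : bC α θ x = (amp α θ x : ℂ) := by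
  rw [bC, qC_ofReal hx, amp_eq hθ,
    Complex.ofReal_cpow (by linarith [one_le_profile (α := α) hθ x])]

lemma amp_sq (hθ : 0 < θ) (x : ℝ) : amp α θ x ^ 2 = spd α θ x := by
  rw [amp, ← Real.rpow_natCast, ← Real.rpow_mul (spd_pos hθ x).le]
  norm_num

lemma sC_ofReal (hθ : 0 < θ) (hx : 0 < x) : sC α θ x = ((spd α θ x)⁻¹ : ℝ) := by
  rw [sC, bC_ofReal hθ hx, ← amp_sq hθ]
  push_cast
  rfl

lemma ofReal_Mfun (hα : 1 ≤ α) (hθ : 0 < θ) (hx : 0 < x) : (Mfun α θ x : ℂ) = MC α θ x := by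
  have hre : ∀ y : ℝ, 0 < y → (bC α θ y).re = amp α θ y := fun y hy => by
    rw [bC_ofReal hθ hy, Complex.ofReal_re]
  have h1 : ∀ y : ℝ, 0 < y → HasDerivAt (amp α θ) (bC' α θ y).re y := fun y hy => by
    refine (HasDerivAt.real_of_complex (hasDerivAt_bC hα hθ
      (ofReal_mem_sector hy))).congr_of_eventuallyEq ?_
    filter_upwards [lt_mem_nhds hy] with w hw using (hre w hw).symm
  have h2 : HasDerivAt (deriv (amp α θ)) (MC α θ x / bC α θ x).re x := by
    refine (HasDerivAt.real_of_complex (hasDerivAt_bC' hα hθ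
      (ofReal_mem_sector hx))).congr_of_eventuallyEq ?_
    filter_upwards [lt_mem_nhds hx] with w hw using (h1 w hw).deriv
  have h3 : (fun y => spd α θ y ^ ((1 : ℝ) / 2)) = amp α θ := rfl
  rw [Mfun, if_pos hx, h3, h2.deriv]
  change ((amp α θ x * _ : ℝ) : ℂ) = _
  have hb := bC_ne_zero hα hθ (ofReal_mem_sector (α := α) hx)
  have himq : ∃ r : ℝ, (r : ℂ) = MC α θ x / bC α θ x := by
    have e1 : (x : ℂ) ^ ((α : ℂ) - 1) = ((x ^ (α - 1) : ℝ) : ℂ) := by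
      rw [Complex.ofReal_cpow hx.le]; push_cast; rfl
    have e2 : (x : ℂ) ^ ((α : ℂ) - 1 - 1) = ((x ^ (α - 1 - 1) : ℝ) : ℂ) := by
      rw [Complex.ofReal_cpow hx.le]; push_cast; rfl
    refine ⟨amp α θ x ^ 2 * (-(1 / 4) * (θ * (α * ((α - 1) * x ^ (α - 1 - 1))) /
      (1 + θ * (max x 0) ^ α)) + 5 / 16 * (θ * (α * x ^ (α - 1)) /
      (1 + θ * (max x 0) ^ α)) ^ 2) / amp α θ x, ?_⟩
    rw [MC, qC'', qC', e1, e2, bC_ofReal hθ hx, qC_ofReal hx]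
    push_cast
    rfl
  obtain ⟨r, hr⟩ := himq
  rw [← hr, Complex.ofReal_re, Complex.ofReal_mul, hr, ← bC_ofReal hθ hx]
  field_simp

end RealAxis

section Holomorphy

variable {α θ : ℝ}

lemma differentiableOn_sC (hα : 1 ≤ α) (hθ : 0 < θ) :
    DifferentiableOn ℂ (sC α θ) (sector α) := fun _ hz =>
  (((hasDerivAt_bC hα hθ hz).differentiableAt.pow 2).inv
    (pow_ne_zero 2 (bC_ne_zero hα hθ hz))).differentiableWithinAt

lemma differentiableOn_MC (hα : 1 ≤ α) (hθ : 0 < θ) :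
    DifferentiableOn ℂ (MC α θ) (sector α) := fun z hz => by
  have h0 := (hasDerivAt_bC hα hθ hz).differentiableAt
  have h1 := (hasDerivAt_qC (θ := θ) hα hz).differentiableAt
  have h2 := (hasDerivAt_qC' (θ := θ) hα hz).differentiableAt
  have h3 : DifferentiableAt ℂ (qC'' α θ) z :=
    ((((hasDerivAt_id z).cpow_const (c := (α : ℂ) - 1 - 1)
      (mem_slitPlane_of_mem_sector hα hz)).differentiableAt.const_mul
      ((α : ℂ) - 1)).const_mul (α : ℂ)).const_mul (θ : ℂ)
  have hq := qC_ne_zero hα hθ hz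
  exact ((h0.pow 2).mul (((h3.div h1 hq).const_mul _).add
    (((h2.div h1 hq).pow 2).const_mul _))).differentiableWithinAt

end Holomorphy

/-- `φ` is a primitive of `sC` on the sector that restricts to `phase` on the positive axis. -/
def IsPhase (α θ : ℝ) (φ : ℂ → ℂ) : Prop :=
  (∀ z ∈ sector α, HasDerivAt φ (sC α θ z) z) ∧ ∀ x : ℝ, 0 < x → φ x = phase α θ x

section Phase

variable {α θ : ℝ} {φ : ℂ → ℂ} {z : ℂ} {x τ : ℝ}

lemma exists_isPhase (hα : 1 ≤ α) (hθ : 0 < θ) : ∃ φ, IsPhase α θ φ := by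
  obtain ⟨F, hF⟩ := exists_primitive_of_convex (isOpen_sector α) (convex_sector α)
    (ofReal_mem_sector (α := α) one_pos) (differentiableOn_sC hα hθ)
  have hd : ∀ x ∈ Ioi (0 : ℝ), HasDerivAt (fun y : ℝ => F y - phase α θ y) 0 x := fun x hx => by
    have h1 := (hF x (ofReal_mem_sector hx)).comp_ofReal
    have h2 := (hasDerivAt_phase hα hθ x).ofReal_comp
    refine (h1.sub h2).congr_deriv ?_
    rw [sC_ofReal hθ hx, sub_self]
  refine ⟨fun z => F z - (F (1 : ℝ) - phase α θ 1), fun z hz => (hF z hz).sub_const _,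
    fun x hx => ?_⟩
  have := (convex_Ioi (0 : ℝ)).is_const_of_fderivWithin_eq_zero (𝕜 := ℝ)
    (f := fun y : ℝ => F y - phase α θ y)
    (fun y hy => (hd y hy).differentiableAt.differentiableWithinAt)
    (fun y hy => by
      rw [((hd y hy).hasFDerivAt.hasFDerivWithinAt).fderivWithin
        (isOpen_Ioi.uniqueDiffWithinAt hy)]
      ext; simp) hx (one_pos : (0:ℝ) < 1)
  linear_combination this

lemma IsPhase.im_add_dir_le (h : IsPhase α θ φ) (hα : 1 ≤ α) (hθ : 0 < θ) (hz : z ∈ sector α)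
    (hτ : 0 ≤ τ) : (φ (z + τ * dir α)).im ≤ (φ z).im - τ / (2 * α) := by
  have hd : ∀ t : ℝ, 0 ≤ t → HasDerivAt (fun t : ℝ => (φ (z + t * dir α)).im + t / (2 * α))
      ((sC α θ (z + t * dir α) * dir α).im + 1 / (2 * α)) t := fun t ht => by
    have h1 := (h.1 _ (add_dir_mem_sector hα hz ht)).comp t (hasDerivAt_add_dir α z t)
    have h2 := (Complex.imCLM.hasFDerivAt (x := φ (z + t * dir α))).comp_hasDerivAt t h1
    exact h2.add ((hasDerivAt_id t).div_const _)
  have hanti : AntitoneOn (fun t : ℝ => (φ (z + t * dir α)).im + t / (2 * α)) (Ici 0) := by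
    refine antitoneOn_of_deriv_nonpos (convex_Ici 0)
      (fun t ht => (hd t ht).continuousAt.continuousWithinAt) ?_ ?_
    · rw [interior_Ici]
      exact fun t ht => (hd t (le_of_lt ht)).differentiableAt.differentiableWithinAt
    · rw [interior_Ici]
      intro t ht
      rw [(hd t (le_of_lt ht)).deriv]
      linarith [im_sC_mul_dir_le hα hθ (add_dir_mem_sector hα hz (le_of_lt ht))]
  have := hanti (self_mem_Ici (a := (0:ℝ))) (mem_Ici.2 hτ) hτ
  simp only [Complex.ofReal_zero, zero_mul, add_zero, zero_div] at this
  linarith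

lemma IsPhase.norm_exp_two_mul_le (h : IsPhase α θ φ) (hα : 1 ≤ α) (hθ : 0 < θ)
    (hz : z ∈ sector α) (hτ : 0 ≤ τ) :
    ‖Complex.exp (2 * Complex.I * (φ z - φ (z + τ * dir α)))‖ ≤ 1 := by
  rw [Complex.norm_exp, Real.exp_le_one_iff]
  have := h.im_add_dir_le hα hθ hz hτ
  have h0 : 0 ≤ τ / (2 * α) := by positivity
  simp [Complex.mul_re, Complex.mul_im]
  linarith

lemma IsPhase.norm_exp_le (h : IsPhase α θ φ) (hα : 1 ≤ α) (hθ : 0 < θ)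
    (hx : 0 < x) (hτ : 0 ≤ τ) :
    ‖Complex.exp (-Complex.I * φ (x + τ * dir α))‖ ≤ Real.exp (-(τ / (2 * α))) := by
  rw [Complex.norm_exp, Real.exp_le_exp]
  have := h.im_add_dir_le hα hθ (ofReal_mem_sector hx) hτ
  rw [h.2 x hx, Complex.ofReal_im] at this
  simp [Complex.mul_re]
  linarith

lemma norm_exp_neg_I_mul_le (hα : 1 ≤ α) (x : ℝ) (hτ : 0 ≤ τ) :
    ‖Complex.exp (-Complex.I * (x + τ * dir α))‖ ≤ Real.exp (-(τ / (2 * α))) := by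
  rw [Complex.norm_exp, Real.exp_le_exp]
  have : τ / (2 * α) ≤ τ * (1 / α) := by
    rw [mul_one_div]; gcongr; linarith
  simp [Complex.mul_re, Complex.mul_im]
  simp at this
  linarith

lemma abs_phase_sub_le (hα : 1 ≤ α) (hθ : 0 < θ) (hx : 0 < x) :
    |phase α θ x - x| ≤ θ * x ^ α * x := by
  have hd : ∀ y ∈ Icc 0 x, HasDerivWithinAt (fun y => phase α θ y - y) ((spd α θ y)⁻¹ - 1)
      (Icc 0 x) y := fun y _ => ((hasDerivAt_phase hα hθ y).sub (hasDerivAt_id y)).hasDerivWithinAt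
  have hb : ∀ y ∈ Icc 0 x, ‖(spd α θ y)⁻¹ - 1‖ ≤ θ * x ^ α := fun y hy => by
    rcases hy.1.eq_or_lt with rfl | h
    · rw [spd_eq_one hα le_rfl, inv_one, sub_self, norm_zero]
      positivity
    · have := norm_sC_sub_one_le hα hθ (ofReal_mem_sector (α := α) h)
      rw [sC_ofReal hθ h, ← Complex.ofReal_one, ← Complex.ofReal_sub, Complex.norm_real,
        Complex.norm_real, Real.norm_of_nonneg h.le] at this
      exact this.trans (by gcongr; exact hy.2)
  have := (convex_Icc 0 x).norm_image_sub_le_of_norm_hasDerivWithin_le hd hb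
    (left_mem_Icc.2 hx.le) (right_mem_Icc.2 hx.le)
  rwa [phase_zero, sub_zero, sub_zero, sub_zero, Real.norm_eq_abs, Real.norm_of_nonneg hx.le]
    at this

lemma norm_add_mul_dir_le (hα : 1 ≤ α) (hx : 0 < x) (hτ : 0 ≤ τ) :
    ‖(x + τ * dir α : ℂ)‖ ≤ x + 2 * τ := by
  refine (norm_add_le _ _).trans ?_
  rw [norm_mul, Complex.norm_real, Complex.norm_real, Real.norm_of_nonneg hx.le,
    Real.norm_of_nonneg hτ]
  nlinarith [norm_dir_le hα]

lemma IsPhase.norm_sub_le (h : IsPhase α θ φ) (hα : 1 ≤ α) (hθ : 0 < θ)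
    (hx : 0 < x) (hτ : 0 ≤ τ) :
    ‖φ (x + τ * dir α) - (x + τ * dir α)‖ ≤ θ * (x + 2 * τ) ^ (α + 1) := by
  have hα0 : 0 ≤ α := by linarith
  have hd : ∀ t ∈ Icc 0 τ, HasDerivWithinAt
      (fun t : ℝ => φ (x + t * dir α) - (x + t * dir α))
      (sC α θ (x + t * dir α) * dir α - dir α) (Icc 0 τ) t := fun t ht =>
    (((h.1 _ (add_dir_mem_sector hα (ofReal_mem_sector hx) ht.1)).comp t
      (hasDerivAt_add_dir α x t)).sub (hasDerivAt_add_dir α x t)).hasDerivWithinAt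
  have hb : ∀ t ∈ Icc 0 τ, ‖sC α θ (x + t * dir α) * dir α - dir α‖ ≤
      θ * (x + 2 * τ) ^ α * 2 := fun t ht => by
    rw [← sub_one_mul, norm_mul]
    refine mul_le_mul ((norm_sC_sub_one_le hα hθ
      (add_dir_mem_sector hα (ofReal_mem_sector hx) ht.1)).trans ?_) (norm_dir_le hα)
      (norm_nonneg _) (by positivity)
    have := norm_add_mul_dir_le hα hx ht.1
    gcongr
    linarith [ht.2]
  have h2 := (convex_Icc 0 τ).norm_image_sub_le_of_norm_hasDerivWithin_le hd hb
    (left_mem_Icc.2 hτ) (right_mem_Icc.2 hτ)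
  have h1 := abs_phase_sub_le hα hθ hx
  simp only [Complex.ofReal_zero, zero_mul, add_zero, sub_zero, Real.norm_of_nonneg hτ,
    h.2 x hx] at h2
  have h3 : ‖(phase α θ x : ℂ) - x‖ ≤ θ * (x + 2 * τ) ^ α * x := by
    rw [← Complex.ofReal_sub, Complex.norm_real]
    refine h1.trans ?_
    gcongr
    linarith
  rw [Real.rpow_add_one (by positivity)]
  have := norm_le_norm_sub_add (φ (x + τ * dir α) - (x + τ * dir α)) ((phase α θ x : ℂ) - x)
  nlinarith

end Phase

section Majorant

variable {α θ : ℝ} {z : ℂ} {x κ : ℝ}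

lemma integrableOn_sub_one_mul_rpow (hα : 1 ≤ α) (hκ : 0 < κ) :
    IntegrableOn (fun x : ℝ => (α - 1) * x ^ (α - 2)) (Ioc 0 κ) ∧
      ∫ x in Ioc 0 κ, (α - 1) * x ^ (α - 2) ≤ κ ^ (α - 1) := by
  rcases hα.eq_or_lt with rfl | h
  · simp
  · refine ⟨?_, ?_⟩
    · exact (((intervalIntegral.intervalIntegrable_rpow' (a := 0) (b := κ)
        (by linarith : -1 < α - 2)).const_mul (α - 1)).1)
    · rw [integral_const_mul, ← intervalIntegral.integral_of_le hκ.le,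
        integral_rpow (Or.inl (by linarith)), show α - 2 + 1 = α - 1 by ring,
        Real.zero_rpow (by linarith), sub_zero, mul_div_cancel₀ _ (by linarith)]

/-- A radial majorant of `MC`, with crossover at the length scale `κ = θ^(-1/α)`. -/
def majorant (α θ κ x : ℝ) : ℝ :=
  if x ≤ κ then α ^ 2 * 4 ^ α * (θ * ((α - 1) * x ^ (α - 2)) + (κ ^ 2)⁻¹)
  else 2 * α ^ 2 * x ^ (-2 : ℝ)

lemma majorant_nonneg (hα : 1 ≤ α) (hθ : 0 < θ) (hx : 0 < x) : 0 ≤ majorant α θ κ x := by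
  have : 0 ≤ α - 1 := by linarith
  rw [majorant]
  split_ifs <;> positivity

lemma norm_MC_le_majorant (hα : 1 ≤ α) (hθ : 0 < θ) (hκ : 0 < κ) (hκθ : θ * κ ^ α = 1)
    (hz : z ∈ sector α) : ‖MC α θ z‖ ≤ majorant α θ κ z.re := by
  have hx := re_pos_of_mem_sector hα hz
  have h1 := Complex.re_le_norm z
  have h2 := norm_le_two_mul_re hα hz
  have hα1 : 0 ≤ α - 1 := by linarith
  set x := z.re
  rw [majorant]
  split_ifs with h
  · have hY : θ * ‖z‖ ^ α ≤ 2 ^ α * (θ * x ^ α) := by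
      calc _ ≤ θ * (2 * x) ^ α := by gcongr
        _ = _ := by rw [Real.mul_rpow zero_le_two hx.le]; ring
    have h24 : (2 : ℝ) ^ α * 2 ^ α = 4 ^ α := by
      rw [← Real.mul_rpow zero_le_two zero_le_two]; norm_num
    have h2le : (2 : ℝ) ^ α ≤ 4 ^ α := by gcongr; norm_num
    have hr : θ * x ^ α ≤ x / κ := by
      have e : θ * x ^ α = (x / κ) ^ α := by
        rw [Real.div_rpow hx.le hκ.le, eq_div_iff (by positivity)]
        linear_combination x ^ α * hκθ
      rw [e]
      calc (x / κ) ^ α ≤ (x / κ) ^ (1 : ℝ) :=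
            Real.rpow_le_rpow_of_exponent_ge (by positivity) ((div_le_one hκ).2 h) hα
        _ = _ := Real.rpow_one _
    have hr0 : 0 ≤ θ * x ^ α := by positivity
    have hp : x ^ α = x ^ (α - 2) * x ^ 2 := by
      rw [← Real.rpow_natCast, ← Real.rpow_add hx]; norm_num
    calc ‖MC α θ z‖ ≤ _ := norm_MC_le' hα hθ hz
      _ ≤ α ^ 2 * ((α - 1) * (2 ^ α * (θ * x ^ α)) + (2 ^ α * (θ * x ^ α)) ^ 2) / x ^ 2 := by
          gcongr
      _ ≤ α ^ 2 * ((α - 1) * (4 ^ α * (θ * x ^ α)) + 4 ^ α * (x / κ) ^ 2) / x ^ 2 := by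
          have : (2 ^ α * (θ * x ^ α)) ^ 2 ≤ 4 ^ α * (x / κ) ^ 2 := by
            calc _ = 4 ^ α * (θ * x ^ α) ^ 2 := by rw [← h24]; ring
              _ ≤ _ := by gcongr
          gcongr
      _ = _ := by
          rw [hp]; field_simp
  · rw [Real.rpow_neg hx.le, ← div_eq_mul_inv, ← Nat.cast_two, Real.rpow_natCast]
    exact (norm_MC_le hα hθ hz).trans (by push_cast; gcongr)

lemma majorant_integral (hα : 1 ≤ α) (hθ : 0 < θ) (hκ : 0 < κ) (hκθ : θ * κ ^ α = 1) :
    IntegrableOn (majorant α θ κ) (Ioi 0) ∧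
      ∫ x in Ioi 0, majorant α θ κ x ≤ (α ^ 2 * 4 ^ α * 2 + 2 * α ^ 2) * κ⁻¹ := by
  obtain ⟨hi, hI⟩ := integrableOn_sub_one_mul_rpow hα hκ
  have hc : IntegrableOn (fun _ : ℝ => (κ ^ 2)⁻¹) (Ioc 0 κ) :=
    integrableOn_const measure_Ioc_lt_top.ne
  have hi1 := ((hi.const_mul θ).add hc).const_mul (α ^ 2 * 4 ^ α)
  have hi2 := (integrableOn_Ioi_rpow_of_lt (by norm_num : (-2 : ℝ) < -1) hκ).const_mul (2 * α ^ 2)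
  have e1 : EqOn (majorant α θ κ)
      (fun x => α ^ 2 * 4 ^ α * (θ * ((α - 1) * x ^ (α - 2)) + (κ ^ 2)⁻¹)) (Ioc 0 κ) :=
    fun x hx => if_pos hx.2
  have e2 : EqOn (majorant α θ κ) (fun x => 2 * α ^ 2 * x ^ (-2 : ℝ)) (Ioi κ) :=
    fun x hx => if_neg (not_le.2 hx)
  have j1 : IntegrableOn (majorant α θ κ) (Ioc 0 κ) := 
    IntegrableOn.congr_fun hi1 e1.symm measurableSet_Ioc
  have j2 : IntegrableOn (majorant α θ κ) (Ioi κ) := 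
    IntegrableOn.congr_fun hi2 e2.symm measurableSet_Ioi
  have hu : Ioc 0 κ ∪ Ioi κ = Ioi 0 := Ioc_union_Ioi_eq_Ioi hκ.le
  refine ⟨hu ▸ j1.union j2, ?_⟩
  rw [← hu, setIntegral_union (Ioc_disjoint_Ioi le_rfl) measurableSet_Ioi j1 j2,
    setIntegral_congr_fun measurableSet_Ioc e1, setIntegral_congr_fun measurableSet_Ioi e2,
    integral_const_mul, integral_const_mul, integral_add (hi.const_mul θ) hc, integral_const_mul,
    integral_Ioi_rpow_of_lt (by norm_num) hκ, setIntegral_const]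
  have h3 : θ * κ ^ (α - 1) = κ⁻¹ := by
    rw [Real.rpow_sub_one hκ.ne', ← mul_div_assoc, hκθ, one_div]
  have h4 : θ * ∫ x in Ioc 0 κ, (α - 1) * x ^ (α - 2) ≤ κ⁻¹ := by
    rw [← h3]; gcongr
  have h5 : volume.real (Ioc 0 κ) • (κ ^ 2)⁻¹ = κ⁻¹ := by
    rw [Real.volume_real_Ioc_of_le hκ.le, smul_eq_mul, sub_zero]; field_simp
  have h6 : -κ ^ ((-2 : ℝ) + 1) / (-2 + 1) = κ⁻¹ := by
    norm_num [Real.rpow_neg_one]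
  rw [h5, h6]
  have : α ^ 2 * 4 ^ α * (θ * ∫ x in Ioc 0 κ, (α - 1) * x ^ (α - 2)) ≤ α ^ 2 * 4 ^ α * κ⁻¹ := by
    gcongr
  linarith

lemma setIntegral_comp_add_le {G : ℝ → ℝ} (hG : IntegrableOn G (Ioi 0))
    (h0 : ∀ x, 0 < x → 0 ≤ G x) (hx : 0 < x) :
    IntegrableOn (fun τ => G (x + τ)) (Ioi 0) ∧
      ∫ τ in Ioi 0, G (x + τ) ≤ ∫ y in Ioi 0, G y := by
  have hsub : Ioi x ⊆ Ioi (0 : ℝ) := Ioi_subset_Ioi hx.le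
  have hpre : (fun τ => x + τ) ⁻¹' Ioi x = Ioi 0 := by
    ext τ; simp
  have hmp := measurePreserving_add_left (volume : Measure ℝ) x
  have hme := (Homeomorph.addLeft x).measurableEmbedding
  refine ⟨?_, ?_⟩
  · have := (hmp.integrableOn_comp_preimage hme (f := G) (s := Ioi x)).2 (hG.mono_set hsub)
    rwa [hpre] at this
  · have := hmp.setIntegral_preimage_emb hme G (Ioi x)
    rw [hpre] at this
    rw [this]
    exact setIntegral_mono_set hG ((ae_restrict_iff' measurableSet_Ioi).2
      (ae_of_all _ fun y hy => h0 y hy)) hsub.eventuallyLE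

/-- The constant in the `L¹` bound for `MC`. -/
def cM (α : ℝ) : ℝ := α ^ 2 * 4 ^ α * 2 + 2 * α ^ 2

lemma cM_pos (hα : 1 ≤ α) : 0 < cM α := by
  rw [cM]; positivity

lemma exists_majorant (hα : 1 ≤ α) (hθ : 0 < θ) : ∃ G : ℝ → ℝ, IntegrableOn G (Ioi 0) ∧
    (∀ x, 0 < x → 0 ≤ G x) ∧ (∀ z ∈ sector α, ‖MC α θ z‖ ≤ G z.re) ∧
      ∫ x in Ioi 0, G x ≤ cM α * θ ^ (1 / α) := by
  have hα0 : 0 < α := by linarith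
  have hκ : 0 < θ ^ (-(1 / α)) := by positivity
  have hκθ : θ * (θ ^ (-(1 / α))) ^ α = 1 := by
    rw [← Real.rpow_mul hθ.le, neg_mul, one_div_mul_cancel hα0.ne', Real.rpow_neg_one,
      mul_inv_cancel₀ hθ.ne']
  obtain ⟨h1, h2⟩ := majorant_integral hα hθ hκ hκθ
  refine ⟨_, h1, fun x hx => majorant_nonneg hα hθ hx,
    fun z hz => norm_MC_le_majorant hα hθ hκ hκθ hz, ?_⟩
  refine h2.trans_eq ?_
  rw [Real.rpow_neg hθ.le, inv_inv, cM]

lemma integral_norm_MC_le (hα : 1 ≤ α) (hθ : 0 < θ) (hz : z ∈ sector α) :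
    IntegrableOn (fun τ : ℝ => ‖MC α θ (z + τ * dir α)‖) (Ioi 0) ∧
      ∫ τ in Ioi (0 : ℝ), ‖MC α θ (z + τ * dir α)‖ ≤ cM α * θ ^ (1 / α) := by
  obtain ⟨G, hG, h0, hMG, hGi⟩ := exists_majorant hα hθ
  obtain ⟨h1, h2⟩ := setIntegral_comp_add_le hG h0 (re_pos_of_mem_sector hα hz)
  have hb : ∀ τ ∈ Ioi (0 : ℝ), ‖MC α θ (z + τ * dir α)‖ ≤ G (z.re + τ) := fun τ hτ => by
    have := hMG _ (add_dir_mem_sector hα hz (le_of_lt hτ))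
    simpa using this
  have hi : IntegrableOn (fun τ : ℝ => ‖MC α θ (z + τ * dir α)‖) (Ioi 0) := by
    refine h1.mono' ?_ ((ae_restrict_iff' measurableSet_Ioi).2 (ae_of_all _ fun τ hτ => ?_))
    · exact (((continuousOn_comp_add_dir hα (differentiableOn_MC hα hθ).continuousOn
        hz).norm.mono Ioi_subset_Ici_self).aestronglyMeasurable measurableSet_Ioi)
    · rw [norm_norm]; exact hb τ hτ
  exact ⟨hi, (setIntegral_mono_on hi h1 measurableSet_Ioi hb).trans (h2.trans hGi)⟩

lemma continuousOn_Mfun (hα : 1 ≤ α) (hθ : 0 < θ) : ContinuousOn (Mfun α θ) (Ioi 0) := by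
  have : ContinuousOn (fun x : ℝ => (MC α θ x).re) (Ioi 0) :=
    Complex.continuous_re.comp_continuousOn ((differentiableOn_MC hα hθ).continuousOn.comp
      Complex.continuous_ofReal.continuousOn fun x hx => ofReal_mem_sector hx)
  refine this.congr fun x hx => ?_
  change _ = (MC α θ x).re
  rw [← ofReal_Mfun hα hθ hx, Complex.ofReal_re]

lemma integrableOn_Mfun (hα : 1 ≤ α) (hθ : 0 < θ) :
    IntegrableOn (Mfun α θ) (Ioi 0) ∧ ∫ x in Ioi 0, |Mfun α θ x| ≤ cM α * θ ^ (1 / α) := by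
  obtain ⟨G, hG, h0, hMG, hGi⟩ := exists_majorant hα hθ
  have hb : ∀ x ∈ Ioi (0 : ℝ), ‖Mfun α θ x‖ ≤ G x := fun x hx => by
    have := hMG _ (ofReal_mem_sector hx)
    rwa [← ofReal_Mfun hα hθ hx, Complex.norm_real, Complex.ofReal_re] at this
  have hi : IntegrableOn (Mfun α θ) (Ioi 0) := hG.mono'
    ((continuousOn_Mfun hα hθ).aestronglyMeasurable measurableSet_Ioi)
    ((ae_restrict_iff' measurableSet_Ioi).2 (ae_of_all _ hb))
  exact ⟨hi, (setIntegral_mono_on hi.norm hG measurableSet_Ioi hb).trans hGi⟩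

lemma Mtail_le (hα : 1 ≤ α) (hθ : 0 < θ) {x₀ : ℝ} (hx₀ : 0 < x₀) :
    Mtail α θ x₀ ≤ cM α * θ ^ (1 / α) := by
  obtain ⟨h1, h2⟩ := integrableOn_Mfun hα hθ
  exact (setIntegral_mono_set h1.norm (ae_of_all _ fun x => norm_nonneg _)
    (Ioi_subset_Ioi hx₀.le).eventuallyLE).trans h2

end Majorant

/-- A holomorphic nonvanishing weight on the sector, nonincreasing along the rays of direction
`dir α`. -/
structure IsWeight (α : ℝ) (w w' : ℂ → ℂ) : Prop where
  ne_zero : ∀ z ∈ sector α, w z ≠ 0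
  hasDerivAt : ∀ z ∈ sector α, HasDerivAt w (w' z) z
  norm_le : ∀ z ∈ sector α, ∀ τ : ℝ, 0 ≤ τ → ‖w (z + τ * dir α)‖ ≤ ‖w z‖

/-- The weighted tail operator `f ↦ (2i)⁻¹ w(z)⁻¹ ∫ w M f` along the ray from `z`. -/
def tailOp (α θ : ℝ) (w f : ℂ → ℂ) (z : ℂ) : ℂ :=
  (2 * Complex.I)⁻¹ * ((w z)⁻¹ *
    ∫ τ in Ioi (0 : ℝ), w (z + τ * dir α) * (MC α θ (z + τ * dir α) * f (z + τ * dir α)) * dir α)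

/-- The weight `e^(-2iφ)`. -/
def expWeight (φ : ℂ → ℂ) (z : ℂ) : ℂ := Complex.exp (-2 * Complex.I * φ z)

section TailOp

variable {α θ C : ℝ} {w w' f g : ℂ → ℂ} {z : ℂ}

lemma IsWeight.continuousOn (hw : IsWeight α w w') : ContinuousOn w (sector α) :=
  fun z hz => (hw.hasDerivAt z hz).continuousAt.continuousWithinAt

lemma IsWeight.one (α : ℝ) : IsWeight α (fun _ => 1) (fun _ => 0) where
  ne_zero := fun _ _ => one_ne_zero
  hasDerivAt := fun _ _ => hasDerivAt_const _ _
  norm_le := fun _ _ _ _ => le_rfl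

lemma IsPhase.isWeight {φ : ℂ → ℂ} (h : IsPhase α θ φ) (hα : 1 ≤ α) (hθ : 0 < θ) :
    IsWeight α (expWeight φ)
      (fun z => expWeight φ z * (-2 * Complex.I * sC α θ z)) where
  ne_zero := fun _ _ => Complex.exp_ne_zero _
  hasDerivAt := fun z hz => ((h.1 z hz).const_mul _).cexp
  norm_le := fun z hz τ hτ => by
    have h1 := h.norm_exp_two_mul_le hα hθ hz hτ
    have h2 : expWeight φ (z + τ * dir α) =
        Complex.exp (2 * Complex.I * (φ z - φ (z + τ * dir α))) * expWeight φ z := by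
      rw [expWeight, expWeight, ← Complex.exp_add]; ring_nf
    rw [h2, norm_mul]
    exact mul_le_of_le_one_left (norm_nonneg _) h1

lemma norm_MC_add_dir_le (hα : 1 ≤ α) (hθ : 0 < θ) (hz : z ∈ sector α) {τ : ℝ} (hτ : 0 ≤ τ) :
    ‖MC α θ (z + τ * dir α)‖ ≤ 2 * α ^ 2 * (z.re + τ) ^ (-2 : ℝ) := by
  have hz' := add_dir_mem_sector hα hz hτ
  have h1 := re_pos_of_mem_sector hα hz'
  have h2 := Complex.re_le_norm (z + τ * dir α)
  have h3 : (z + τ * dir α).re = z.re + τ := by simp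
  rw [← h3, Real.rpow_neg h1.le, ← div_eq_mul_inv, ← Nat.cast_two, Real.rpow_natCast]
  refine (norm_MC_le hα hθ hz').trans ?_
  push_cast
  gcongr

lemma norm_weight_mul_le (hα : 1 ≤ α) (hw : IsWeight α w w')
    (hf : ∀ z ∈ sector α, ‖f z‖ ≤ C) (hz : z ∈ sector α) {τ : ℝ} (hτ : 0 ≤ τ) :
    ‖w (z + τ * dir α) * (MC α θ (z + τ * dir α) * f (z + τ * dir α))‖ ≤
      ‖w z‖ * C * ‖MC α θ (z + τ * dir α)‖ := by
  have h1 := hw.norm_le z hz τ hτ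
  have h2 := hf _ (add_dir_mem_sector hα hz hτ)
  rw [norm_mul, norm_mul]
  calc _ ≤ ‖w z‖ * (‖MC α θ (z + τ * dir α)‖ * C) := by gcongr
    _ = _ := by ring

lemma continuousOn_weight_mul (hα : 1 ≤ α) (hθ : 0 < θ) (hw : IsWeight α w w')
    (hf : ContinuousOn f (sector α)) :
    ContinuousOn (fun z => w z * (MC α θ z * f z)) (sector α) :=
  hw.continuousOn.mul ((differentiableOn_MC hα hθ).continuousOn.mul hf)

lemma integrableOn_weight_mul (hα : 1 ≤ α) (hθ : 0 < θ) (hw : IsWeight α w w')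
    (hfc : ContinuousOn f (sector α)) (hf : ∀ z ∈ sector α, ‖f z‖ ≤ C) (hz : z ∈ sector α) :
    IntegrableOn (fun τ : ℝ => w (z + τ * dir α) *
      (MC α θ (z + τ * dir α) * f (z + τ * dir α)) * dir α) (Ioi 0) := by
  have h1 := ((integral_norm_MC_le hα hθ hz).1.const_mul (‖w z‖ * C)).mul_const 2
  have hC : 0 ≤ C := (norm_nonneg _).trans (hf z hz)
  refine h1.mono' ?_ ((ae_restrict_iff' measurableSet_Ioi).2 (ae_of_all _ fun τ hτ => ?_))
  · exact ((continuousOn_comp_add_dir hα (continuousOn_weight_mul hα hθ hw hfc)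
      hz).mul_const _ |>.mono Ioi_subset_Ici_self).aestronglyMeasurable measurableSet_Ioi
  · rw [norm_mul]
    exact mul_le_mul (norm_weight_mul_le hα hw hf hz (le_of_lt hτ)) (norm_dir_le hα)
      (norm_nonneg _) (by positivity)

lemma norm_tailOp_le_aux (hα : 1 ≤ α) (hw : IsWeight α w w')
    (hf : ∀ z ∈ sector α, ‖f z‖ ≤ C) (hz : z ∈ sector α) {G : ℝ → ℝ}
    (hG : IntegrableOn G (Ioi 0)) (hMG : ∀ τ : ℝ, 0 < τ → ‖MC α θ (z + τ * dir α)‖ ≤ G τ) :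
    ‖tailOp α θ w f z‖ ≤ C * ∫ τ in Ioi 0, G τ := by
  have hC : 0 ≤ C := (norm_nonneg _).trans (hf z hz)
  have h0 := norm_pos_iff.2 (hw.ne_zero z hz)
  have h1 : ‖∫ τ in Ioi (0 : ℝ), w (z + τ * dir α) *
      (MC α θ (z + τ * dir α) * f (z + τ * dir α)) * dir α‖ ≤
      ∫ τ in Ioi 0, ‖w z‖ * C * G τ * 2 := by
    refine norm_integral_le_of_norm_le ((hG.const_mul _).mul_const 2)
      ((ae_restrict_iff' measurableSet_Ioi).2 (ae_of_all _ fun τ hτ => ?_))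
    rw [norm_mul]
    have h2 := norm_weight_mul_le (θ := θ) hα hw hf hz (le_of_lt hτ)
    have h3 := hMG τ hτ
    refine mul_le_mul (h2.trans (by gcongr)) (norm_dir_le hα) (norm_nonneg _) ?_
    exact (norm_nonneg _).trans (h2.trans (by gcongr))
  rw [integral_mul_const (2 : ℝ), integral_const_mul (‖w z‖ * C)] at h1
  rw [tailOp, norm_mul, norm_mul, norm_inv, norm_inv, norm_mul, Complex.norm_I, Complex.norm_ofNat]
  calc _ ≤ (2 * 1 : ℝ)⁻¹ * (‖w z‖⁻¹ * (‖w z‖ * C * (∫ τ in Ioi 0, G τ) * 2)) := by gcongr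
    _ = _ := by field_simp

lemma norm_tailOp_le (hα : 1 ≤ α) (hθ : 0 < θ) (hw : IsWeight α w w')
    (hf : ∀ z ∈ sector α, ‖f z‖ ≤ C) (hz : z ∈ sector α) :
    ‖tailOp α θ w f z‖ ≤ C * (cM α * θ ^ (1 / α)) := by
  obtain ⟨h1, h2⟩ := integral_norm_MC_le hα hθ hz
  have hC : 0 ≤ C := (norm_nonneg _).trans (hf z hz)
  exact (norm_tailOp_le_aux hα hw hf hz h1 fun _ _ => le_rfl).trans (by gcongr)

lemma norm_tailOp_le_div_re (hα : 1 ≤ α) (hθ : 0 < θ) (hw : IsWeight α w w')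
    (hf : ∀ z ∈ sector α, ‖f z‖ ≤ C) (hz : z ∈ sector α) :
    ‖tailOp α θ w f z‖ ≤ C * (2 * α ^ 2 / z.re) := by
  have hx := re_pos_of_mem_sector hα hz
  have := norm_tailOp_le_aux hα hw hf hz
    ((integrableOn_add_rpow_neg_two hx).const_mul (2 * α ^ 2))
    fun τ hτ => norm_MC_add_dir_le hα hθ hz (le_of_lt hτ)
  rwa [integral_const_mul, integral_add_rpow_neg_two hx, ← div_eq_mul_inv] at this

lemma tailOp_sub (hα : 1 ≤ α) (hθ : 0 < θ) (hw : IsWeight α w w') {D : ℝ}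
    (hfc : ContinuousOn f (sector α)) (hf : ∀ z ∈ sector α, ‖f z‖ ≤ C)
    (hgc : ContinuousOn g (sector α)) (hg : ∀ z ∈ sector α, ‖g z‖ ≤ D) (hz : z ∈ sector α) :
    tailOp α θ w (f - g) z = tailOp α θ w f z - tailOp α θ w g z := by
  rw [tailOp, tailOp, tailOp, ← mul_sub, ← mul_sub,
    ← integral_sub (integrableOn_weight_mul hα hθ hw hfc hf hz)
      (integrableOn_weight_mul hα hθ hw hgc hg hz)]
  congr 3
  ext τ
  simp only [Pi.sub_apply]
  ring

lemma hasDerivAt_tailOp (hα : 1 ≤ α) (hθ : 0 < θ) (hw : IsWeight α w w')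
    (hfd : DifferentiableOn ℂ f (sector α)) (hf : ∀ z ∈ sector α, ‖f z‖ ≤ C)
    (hz : z ∈ sector α) :
    HasDerivAt (tailOp α θ w f)
      (-(w' z / w z) * tailOp α θ w f z - (2 * Complex.I)⁻¹ * (MC α θ z * f z)) z := by
  have hC : 0 ≤ C := (norm_nonneg _).trans (hf z hz)
  have h0 := hw.ne_zero z hz
  have hd : DifferentiableOn ℂ (fun z => w z * (MC α θ z * f z)) (sector α) :=
    DifferentiableOn.mul
      (fun y hy => (hw.hasDerivAt y hy).differentiableAt.differentiableWithinAt)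
      ((differentiableOn_MC hα hθ).mul hfd)
  have hh : ContinuousOn (fun z => ‖w z‖ * C * (2 * α ^ 2)) (sector α) :=
    (hw.continuousOn.norm.mul_const C).mul_const _
  have h1 := hasDerivAt_tail hα hd hh (fun y hy τ hτ => by
    refine (norm_weight_mul_le hα hw hf hy hτ).trans ?_
    rw [mul_assoc (‖w y‖ * C)]
    gcongr
    exact norm_MC_add_dir_le hα hθ hy hτ) hz
  have h2 := (((hw.hasDerivAt z hz).inv h0).mul h1).const_mul (2 * Complex.I)⁻¹
  refine h2.congr_deriv ?_
  rw [tailOp]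
  simp only [Pi.inv_apply]
  generalize (∫ τ in Ioi (0 : ℝ), w (z + τ * dir α) *
    (MC α θ (z + τ * dir α) * f (z + τ * dir α)) * dir α) = I
  field_simp
  ring

end TailOp

lemma exists_holomorphic_fixedPoint {U : Set ℂ} (hU : IsOpen U) {K : (ℂ → ℂ) → ℂ → ℂ} {l : ℝ}
    (hl : l ≤ 1 / 2)
    (hd : ∀ f C, DifferentiableOn ℂ f U → (∀ z ∈ U, ‖f z‖ ≤ C) → DifferentiableOn ℂ (K f) U)
    (hb : ∀ f C, (∀ z ∈ U, ‖f z‖ ≤ C) → ∀ z ∈ U, ‖K f z‖ ≤ C * l)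
    (hs : ∀ f g C D, DifferentiableOn ℂ f U → (∀ z ∈ U, ‖f z‖ ≤ C) → DifferentiableOn ℂ g U →
      (∀ z ∈ U, ‖g z‖ ≤ D) → ∀ z ∈ U, K (f - g) z = K f z - K g z) :
    ∃ T : ℂ → ℂ, DifferentiableOn ℂ T U ∧ (∀ z ∈ U, ‖T z‖ ≤ 2) ∧ ∀ z ∈ U, T z = 1 + K T z := by
  set F : ℕ → ℂ → ℂ := fun n => (fun f z => 1 + K f z)^[n] (fun _ => 1) with hF
  have hsucc : ∀ n z, F (n + 1) z = 1 + K (F n) z := fun n z => by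
    simp only [hF, Function.iterate_succ_apply']
  have hA : ∀ n, DifferentiableOn ℂ (F n) U ∧ ∀ z ∈ U, ‖F n z‖ ≤ 2 := fun n => by
    induction n with
    | zero => exact ⟨differentiableOn_const _, fun z _ => by simp [hF]⟩
    | succ n ih =>
      refine ⟨((hd _ _ ih.1 ih.2).const_add 1).congr fun z _ => hsucc n z, fun z hz => ?_⟩
      rw [hsucc]
      refine (norm_add_le _ _).trans ?_
      rw [norm_one]
      linarith [hb _ _ ih.2 z hz]
  have hB : ∀ n, ∀ z ∈ U, ‖F (n + 1) z - F n z‖ ≤ (1 / 2) ^ n := fun n => by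
    induction n with
    | zero =>
      intro z hz
      have h1 : ∀ z ∈ U, ‖F 0 z‖ ≤ 1 := fun z _ => by simp [hF]
      have := hb _ _ h1 z hz
      rw [hsucc, show F 0 z = 1 from rfl, add_sub_cancel_left, pow_zero]
      linarith
    | succ n ih =>
      intro z hz
      have := hb (F (n + 1) - F n) _ ih z hz
      rw [hs _ _ 2 2 (hA _).1 (hA _).2 (hA _).1 (hA _).2 z hz] at this
      rw [hsucc, hsucc n, add_sub_add_left_eq_sub, pow_succ]
      exact this.trans (by gcongr)
  have hC : ∀ z ∈ U, ∃ t, Tendsto (fun n => F n z) atTop (𝓝 t) := fun z hz =>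
    cauchySeq_tendsto_of_complete (cauchySeq_of_le_geometric (1 / 2) 1 (by norm_num) fun n => by
      rw [dist_comm, dist_eq_norm, one_mul]; exact hB n z hz)
  choose! T hT using hC
  have hdist : ∀ n, ∀ z ∈ U, dist (F n z) (T z) ≤ 2 * (1 / 2) ^ n := fun n z hz => by
    have := dist_le_of_le_geometric_of_tendsto (1 / 2 : ℝ) 1 (by norm_num) (fun n => by
      rw [dist_comm, dist_eq_norm, one_mul]; exact hB n z hz) (hT z hz) n
    refine this.trans_eq ?_
    ring
  have hlim : Tendsto (fun n : ℕ => 2 * (1 / 2 : ℝ) ^ n) atTop (𝓝 0) := by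
    simpa using (tendsto_pow_atTop_nhds_zero_of_lt_one (r := (1 / 2 : ℝ)) (by norm_num)
      (by norm_num)).const_mul 2
  have hunif : TendstoUniformlyOn F T atTop U := by
    rw [Metric.tendstoUniformlyOn_iff]
    intro ε hε
    filter_upwards [hlim.eventually (gt_mem_nhds hε)] with n hn z hz
    rw [dist_comm]
    exact (hdist n z hz).trans_lt hn
  have hTd : DifferentiableOn ℂ T U := hunif.tendstoLocallyUniformlyOn.differentiableOn
    (Eventually.of_forall fun n => (hA n).1) hU
  have hTb : ∀ z ∈ U, ‖T z‖ ≤ 2 := fun z hz =>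
    le_of_tendsto (hT z hz).norm (Eventually.of_forall fun n => (hA n).2 z hz)
  refine ⟨T, hTd, hTb, fun z hz => ?_⟩
  have h1 : Tendsto (fun n => K (F n) z) atTop (𝓝 (K T z)) := by
    rw [tendsto_iff_norm_sub_tendsto_zero]
    refine squeeze_zero (fun _ => norm_nonneg _) (fun n => ?_) hlim
    rw [← hs _ _ 2 2 (hA n).1 (hA n).2 hTd hTb z hz]
    have h2 : ∀ z ∈ U, ‖(F n - T) z‖ ≤ 2 * (1 / 2) ^ n := fun z hz => by
      rw [Pi.sub_apply, ← dist_eq_norm]; exact hdist n z hz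
    refine (hb _ _ h2 z hz).trans ?_
    have : (0 : ℝ) ≤ 2 * (1 / 2) ^ n := by positivity
    nlinarith
  refine tendsto_nhds_unique ((hT z hz).comp (tendsto_add_atTop_nat 1)) ?_
  refine (h1.const_add 1).congr fun n => ?_
  rw [Function.comp_apply, hsucc]

/-- `T` is the bounded holomorphic amplitude of the recessive solution `b e^(-iφ) T`. -/
structure IsAmplitude (α θ : ℝ) (φ T : ℂ → ℂ) : Prop where
  differentiableOn : DifferentiableOn ℂ T (sector α)
  norm_le : ∀ z ∈ sector α, ‖T z‖ ≤ 2
  eq : ∀ z ∈ sector α, T z = 1 + (tailOp α θ (expWeight φ) T z - tailOp α θ (fun _ => 1) T z)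

section Amplitude

variable {α θ : ℝ} {φ T : ℂ → ℂ} {z : ℂ}

lemma exists_isAmplitude (hα : 1 ≤ α) (hθ : 0 < θ) (hφ : IsPhase α θ φ)
    (hl : cM α * θ ^ (1 / α) ≤ 1 / 4) : ∃ T, IsAmplitude α θ φ T := by
  have hw := hφ.isWeight hα hθ
  have h1 := IsWeight.one α
  obtain ⟨T, hT1, hT2, hT3⟩ := exists_holomorphic_fixedPoint (isOpen_sector α)
    (K := fun f z => tailOp α θ (expWeight φ) f z - tailOp α θ (fun _ => 1) f z)
    (l := 2 * (cM α * θ ^ (1 / α))) (by linarith)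
    (fun f C hf hC z hz => ((hasDerivAt_tailOp hα hθ hw hf hC hz).differentiableAt.sub
      (hasDerivAt_tailOp hα hθ h1 hf hC hz).differentiableAt).differentiableWithinAt)
    (fun f C hC z hz => by
      have e1 := norm_tailOp_le hα hθ hw hC hz
      have e2 := norm_tailOp_le hα hθ h1 hC hz
      refine (norm_sub_le _ _).trans ?_
      linarith)
    (fun f g C D hf hC hg hD z hz => by
      have e1 := tailOp_sub hα hθ hw hf.continuousOn hC hg.continuousOn hD hz
      have e2 := tailOp_sub hα hθ h1 hf.continuousOn hC hg.continuousOn hD hz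
      simp only [e1, e2]
      ring)
  exact ⟨T, hT1, hT2, hT3⟩

namespace IsAmplitude

lemma norm_sub_one_le (hT : IsAmplitude α θ φ T) (hφ : IsPhase α θ φ) (hα : 1 ≤ α) (hθ : 0 < θ)
    (hz : z ∈ sector α) : ‖T z - 1‖ ≤ 4 * (cM α * θ ^ (1 / α)) := by
  have e1 := norm_tailOp_le hα hθ (hφ.isWeight hα hθ) hT.norm_le hz
  have e2 := norm_tailOp_le hα hθ (IsWeight.one α) hT.norm_le hz
  rw [hT.eq z hz, add_sub_cancel_left]
  refine (norm_sub_le _ _).trans ?_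
  linarith

lemma hasDerivAt_tailOp_exp (hT : IsAmplitude α θ φ T) (hφ : IsPhase α θ φ) (hα : 1 ≤ α)
    (hθ : 0 < θ) (hz : z ∈ sector α) :
    HasDerivAt (tailOp α θ (expWeight φ) T)
      (2 * Complex.I * sC α θ z * tailOp α θ (expWeight φ) T z -
        (2 * Complex.I)⁻¹ * (MC α θ z * T z)) z := by
  refine (hasDerivAt_tailOp hα hθ (hφ.isWeight hα hθ) hT.differentiableOn hT.norm_le
    hz).congr_deriv ?_
  rw [mul_div_cancel_left₀ _ ((hφ.isWeight hα hθ).ne_zero z hz)]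
  ring

lemma hasDerivAt (hT : IsAmplitude α θ φ T) (hφ : IsPhase α θ φ) (hα : 1 ≤ α)
    (hθ : 0 < θ) (hz : z ∈ sector α) :
    HasDerivAt T (2 * Complex.I * sC α θ z * tailOp α θ (expWeight φ) T z) z := by
  have h1 := hT.hasDerivAt_tailOp_exp hφ hα hθ hz
  have h2 := hasDerivAt_tailOp hα hθ (IsWeight.one α) hT.differentiableOn hT.norm_le hz
  refine (((h1.sub h2).const_add 1).congr_deriv ?_).congr_of_eventuallyEq ?_
  · simp
  · filter_upwards [(isOpen_sector α).mem_nhds hz] with y hy using hT.eq y hy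

end IsAmplitude

/-- The recessive solution of the wave equation with coefficient `qC`. -/
def solC (α θ : ℝ) (φ T : ℂ → ℂ) (z : ℂ) : ℂ :=
  bC α θ z * Complex.exp (-Complex.I * φ z) * T z

/-- The derivative of `solC`. -/
def solC' (α θ : ℝ) (φ T : ℂ → ℂ) (z : ℂ) : ℂ :=
  Complex.exp (-Complex.I * φ z) * (bC' α θ z * T z +
    (bC α θ z)⁻¹ * (-Complex.I * T z + 2 * Complex.I * tailOp α θ (expWeight φ) T z))

namespace IsAmplitude

lemma hasDerivAt_solC (hT : IsAmplitude α θ φ T) (hφ : IsPhase α θ φ) (hα : 1 ≤ α)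
    (hθ : 0 < θ) (hz : z ∈ sector α) :
    HasDerivAt (solC α θ φ T) (solC' α θ φ T z) z := by
  have hb := bC_ne_zero hα hθ hz
  have h := ((hasDerivAt_bC hα hθ hz).mul ((hφ.1 z hz).const_mul (-Complex.I)).cexp).mul
    (hT.hasDerivAt hφ hα hθ hz)
  refine h.congr_deriv ?_
  simp only [solC', sC, Pi.mul_apply]
  field_simp
  ring

lemma hasDerivAt_solC' (hT : IsAmplitude α θ φ T) (hφ : IsPhase α θ φ) (hα : 1 ≤ α)
    (hθ : 0 < θ) (hz : z ∈ sector α) :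
    HasDerivAt (solC' α θ φ T) (-qC α θ z * solC α θ φ T z) z := by
  have hb := bC_ne_zero hα hθ hz
  have hTd := hT.hasDerivAt hφ hα hθ hz
  have hbd := hasDerivAt_bC hα hθ hz
  have h := ((hφ.1 z hz).const_mul (-Complex.I)).cexp.mul
    (((hasDerivAt_bC' hα hθ hz).mul hTd).add ((hbd.inv hb).mul ((hTd.const_mul (-Complex.I)).add
      ((hT.hasDerivAt_tailOp_exp hφ hα hθ hz).const_mul (2 * Complex.I)))))
  refine h.congr_deriv ?_
  have hq : qC α θ z = (bC α θ z ^ 4)⁻¹ := by rw [bC_pow_four, inv_inv]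
  have hI := Complex.I_sq
  simp only [solC, sC, Pi.mul_apply, Pi.add_apply, Pi.inv_apply, hq]
  generalize tailOp α θ (expWeight φ) T z = n
  generalize MC α θ z = m
  generalize Complex.exp (-Complex.I * φ z) = e
  generalize bC' α θ z = b'
  field_simp
  ring_nf
  simp only [hI]
  ring

end IsAmplitude

end Amplitude

lemma eq_of_hasDerivAt_zero_Ioi {f : ℝ → ℂ} {a : ℝ} (h : ∀ x, a < x → HasDerivAt f 0 x)
    {x y : ℝ} (hx : a < x) (hy : a < y) : f x = f y :=
  (convex_Ioi a).is_const_of_fderivWithin_eq_zero (𝕜 := ℝ)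
    (fun y hy => (h y hy).differentiableAt.differentiableWithinAt)
    (fun y hy => by
      rw [((h y hy).hasFDerivAt.hasFDerivWithinAt).fderivWithin
        (isOpen_Ioi.uniqueDiffWithinAt hy)]
      ext; simp) hx hy

section Volterra

variable {α θ x₀ : ℝ} {S : ℝ → ℂ} {x : ℝ}

/-- The tail part `(2i)⁻¹ ∫_x^∞ M S` of the Volterra equation. -/
def volterraTail (α θ : ℝ) (S : ℝ → ℂ) (x : ℝ) : ℂ :=
  (2 * Complex.I)⁻¹ * ∫ y in Ioi x, (Mfun α θ y : ℂ) * S y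

lemma _root_.IsVolterraSol.continuousOn_mul (hS : IsVolterraSol α θ x₀ S) (hα : 1 ≤ α)
    (hθ : 0 < θ) (hx₀ : 0 < x₀) : ContinuousOn (fun y => (Mfun α θ y : ℂ) * S y) (Ici x₀) :=
  (Complex.continuous_ofReal.comp_continuousOn ((continuousOn_Mfun hα hθ).mono
    fun _ hy => hx₀.trans_le hy)).mul hS.2.1

lemma _root_.IsVolterraSol.integrableOn_mul (hS : IsVolterraSol α θ x₀ S) (hα : 1 ≤ α)
    (hθ : 0 < θ) (hx₀ : 0 < x₀) : IntegrableOn (fun y => (Mfun α θ y : ℂ) * S y) (Ioi x₀) := by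
  obtain ⟨C, hC⟩ := hS.1
  have h1 : IntegrableOn (fun y => ‖Mfun α θ y‖ * C) (Ioi x₀) :=
    IntegrableOn.mono_set ((integrableOn_Mfun hα hθ).1.norm.mul_const C) (Ioi_subset_Ioi hx₀.le)
  refine h1.mono' (((hS.continuousOn_mul hα hθ hx₀).mono
    Ioi_subset_Ici_self).aestronglyMeasurable measurableSet_Ioi)
    ((ae_restrict_iff' measurableSet_Ioi).2 (ae_of_all _ fun y hy => ?_))
  rw [norm_mul, Complex.norm_real]
  gcongr
  exact hC y (Ioi_subset_Ici_self hy)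

lemma _root_.IsVolterraSol.volterraTail_eq (hS : IsVolterraSol α θ x₀ S) (hα : 1 ≤ α)
    (hθ : 0 < θ) (hx₀ : 0 < x₀) (hx : x₀ < x) :
    volterraTail α θ S x = (2 * Complex.I)⁻¹ * ((∫ y in Ioi x₀, (Mfun α θ y : ℂ) * S y) -
      ∫ y in x₀..x, (Mfun α θ y : ℂ) * S y) := by
  have hi := hS.integrableOn_mul hα hθ hx₀
  have := intervalIntegral.integral_interval_add_Ioi hi (hi.mono_set (Ioi_subset_Ioi hx.le))
  rw [volterraTail, ← this, add_sub_cancel_left]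

lemma _root_.IsVolterraSol.tendsto_volterraTail (hS : IsVolterraSol α θ x₀ S) (hα : 1 ≤ α)
    (hθ : 0 < θ) (hx₀ : 0 < x₀) : Tendsto (volterraTail α θ S) atTop (𝓝 0) := by
  have hi := hS.integrableOn_mul hα hθ hx₀
  have h1 := intervalIntegral_tendsto_integral_Ioi x₀ hi tendsto_id
  have h2 := (h1.const_sub (∫ y in Ioi x₀, (Mfun α θ y : ℂ) * S y)).const_mul (2 * Complex.I)⁻¹
  rw [sub_self, mul_zero] at h2
  refine h2.congr' ?_
  filter_upwards [eventually_gt_atTop x₀] with x hx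
  rw [hS.volterraTail_eq hα hθ hx₀ hx]
  rfl

lemma hasDerivAt_integral_of_continuousOn_Ici {g : ℝ → ℂ} (hg : ContinuousOn g (Ici x₀))
    (hx : x₀ < x) : HasDerivAt (fun x => ∫ y in x₀..x, g y) (g x) x := by
  have hg' := hg.mono (Ioi_subset_Ici_self (a := x₀))
  refine intervalIntegral.integral_hasDerivAt_right ?_
    (hg'.stronglyMeasurableAtFilter isOpen_Ioi _ hx) (hg'.continuousAt (Ioi_mem_nhds hx))
  refine (hg.mono ?_).intervalIntegrable
  rw [uIcc_of_le hx.le]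
  exact Icc_subset_Ici_self

/-- `S` has derivative `-2i c⁻¹ (S - d)` where `d` is the tail part of the Volterra equation. -/
lemma _root_.IsVolterraSol.hasDerivAt (hS : IsVolterraSol α θ x₀ S) (hα : 1 ≤ α)
    (hθ : 0 < θ) (hx₀ : 0 < x₀) (hx : x₀ < x) :
    HasDerivAt S (-2 * Complex.I * ((spd α θ x)⁻¹ : ℝ) * (S x - volterraTail α θ S x)) x := by
  have hm := hS.continuousOn_mul hα hθ hx₀
  have he : Continuous fun y => Complex.exp (2 * Complex.I * (phase α θ y : ℂ)) := by
    have := continuous_phase hα hθ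
    fun_prop
  set a : ℝ → ℂ := fun x => (2 * Complex.I)⁻¹ *
    ∫ y in x₀..x, (Mfun α θ y : ℂ) * S y * Complex.exp (2 * Complex.I * (phase α θ y : ℂ)) with ha
  set E : ℝ → ℂ := fun x => Complex.exp (-2 * Complex.I * (phase α θ x : ℂ)) with hE
  have hSeq : ∀ y, x₀ < y → S y = E y * (1 + a y) + volterraTail α θ S y := fun y hy => by
    have e1 : ∀ t, (Mfun α θ t : ℂ) * S t * Complex.exp (-2 * Complex.I *
        (1 + Complex.I * ((0 : ℝ) : ℂ)) * ((phase α θ y - phase α θ t : ℝ) : ℂ)) =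
        E y * ((Mfun α θ t : ℂ) * S t * Complex.exp (2 * Complex.I * (phase α θ t : ℂ))) := by
      intro t
      have : Complex.exp (-2 * Complex.I *
          (1 + Complex.I * ((0 : ℝ) : ℂ)) * ((phase α θ y - phase α θ t : ℝ) : ℂ)) =
          E y * Complex.exp (2 * Complex.I * (phase α θ t : ℂ)) := by
        rw [hE, ← Complex.exp_add]
        push_cast
        ring_nf
      rw [this]
      ring
    have h := hS.2.2 y (le_of_lt hy)
    simp only [Kop, e1] at h
    rw [intervalIntegral.integral_const_mul] at h
    rw [h, volterraTail, ha]
    simp only [Complex.ofReal_zero, mul_zero, add_zero, mul_one]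
    ring
  have h1 : HasDerivAt a ((2 * Complex.I)⁻¹ * ((Mfun α θ x : ℂ) * S x *
      Complex.exp (2 * Complex.I * (phase α θ x : ℂ)))) x :=
    (hasDerivAt_integral_of_continuousOn_Ici (hm.mul he.continuousOn) hx).const_mul _
  have h2 : HasDerivAt (volterraTail α θ S)
      ((2 * Complex.I)⁻¹ * -((Mfun α θ x : ℂ) * S x)) x := by
    refine (((hasDerivAt_integral_of_continuousOn_Ici hm hx).const_sub
      (∫ y in Ioi x₀, (Mfun α θ y : ℂ) * S y)).const_mul _).congr_of_eventuallyEq ?_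
    filter_upwards [Ioi_mem_nhds hx] with y hy using hS.volterraTail_eq hα hθ hx₀ hy
  have h3 : HasDerivAt E (E x * (-2 * Complex.I * ((spd α θ x)⁻¹ : ℝ))) x :=
    ((hasDerivAt_phase hα hθ x).ofReal_comp.const_mul (-2 * Complex.I)).cexp
  have h4 : HasDerivAt S (E x * (-2 * Complex.I * ((spd α θ x)⁻¹ : ℝ)) * (1 + a x) +
      E x * ((2 * Complex.I)⁻¹ * ((Mfun α θ x : ℂ) * S x *
        Complex.exp (2 * Complex.I * (phase α θ x : ℂ)))) +
      (2 * Complex.I)⁻¹ * -((Mfun α θ x : ℂ) * S x)) x := by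
    refine ((h3.mul (h1.const_add 1)).add h2).congr_of_eventuallyEq ?_
    filter_upwards [Ioi_mem_nhds hx] with y hy using hSeq y hy
  refine h4.congr_deriv ?_
  have h5 : E x * Complex.exp (2 * Complex.I * (phase α θ x : ℂ)) = 1 := by
    rw [hE, ← Complex.exp_add, ← Complex.exp_zero]
    ring_nf
  have h6 := hSeq x hx
  linear_combination (2 * Complex.I)⁻¹ * ((Mfun α θ x : ℂ) * S x) * h5 +
    (2 * Complex.I * ((spd α θ x)⁻¹ : ℝ)) * h6

end Volterra

section Matching

variable {α θ x₀ : ℝ} {S u u' : ℝ → ℂ} {φ T : ℂ → ℂ} {x : ℝ}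

lemma vminus_ne_zero (hθ : 0 < θ) : vminus α θ x ≠ 0 := by
  refine mul_ne_zero ?_ (Complex.exp_ne_zero _)
  rw [Ne, Complex.ofReal_eq_zero, amp]
  exact (Real.rpow_pos_of_pos (spd_pos hθ x) _).ne'

lemma _root_.IsVolterraSol.deriv_eq (hS : IsVolterraSol α θ x₀ S) (hα : 1 ≤ α)
    (hθ : 0 < θ) (hx₀ : 0 < x₀) (hu : HasDerivAt u (u' x) x)
    (huS : ∀ x ∈ Ici x₀, u x = S x * vminus α θ x) (hx : x₀ < x) :
    u' x = Complex.exp (Complex.I * (phase α θ x : ℂ)) *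
      ((bC' α θ x - Complex.I * (bC α θ x)⁻¹) * S x +
        2 * Complex.I * (bC α θ x)⁻¹ * volterraTail α θ S x) := by
  have hx0 := hx₀.trans hx
  have hz := ofReal_mem_sector (α := α) hx0
  have hb := bC_ne_zero hα hθ hz
  have h1 := ((hS.hasDerivAt hα hθ hx₀ hx).mul ((hasDerivAt_bC hα hθ hz).comp_ofReal.mul
    ((hasDerivAt_phase hα hθ x).ofReal_comp.const_mul Complex.I).cexp))
  have h2 : HasDerivAt u _ x := h1.congr_of_eventuallyEq (by
    filter_upwards [Ioi_mem_nhds hx] with y hy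
    rw [huS y (Ioi_subset_Ici_self hy), vminus, ← bC_ofReal hθ (hx₀.trans hy)]
    rfl)
  rw [hu.unique h2, ← sC_ofReal hθ hx0, sC]
  simp only [Pi.mul_apply]
  generalize volterraTail α θ S x = d
  generalize Complex.exp (Complex.I * (phase α θ x : ℂ)) = e
  field_simp
  ring

lemma exists_eq_mul_solC (hα : 1 ≤ α) (hθ : 0 < θ) (hx₀ : 0 < x₀) (hφ : IsPhase α θ φ)
    (hT : IsAmplitude α θ φ T) (hl : 4 * (cM α * θ ^ (1 / α)) < 1)
    (hS : IsVolterraSol α θ x₀ S) (hu : ∀ x : ℝ, HasDerivAt u (u' x) x)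
    (hu' : ∀ x : ℝ, HasDerivAt u' (-((spd α θ x : ℂ))⁻¹ ^ 2 * u x) x)
    (huS : ∀ x ∈ Ici x₀, u x = S x * vminus α θ x) :
    ∃ l : ℂ, l ≠ 0 ∧ ∀ x : ℝ, 0 < x → u x = l * solC α θ φ T x ∧ u' x = l * solC' α θ φ T x := by
  have hU : ∀ x : ℝ, 0 < x → HasDerivAt (fun x : ℝ => solC α θ φ T x) (solC' α θ φ T x) x :=
    fun x hx => (hT.hasDerivAt_solC hφ hα hθ (ofReal_mem_sector hx)).comp_ofReal
  have hV : ∀ x : ℝ, 0 < x → HasDerivAt (fun x : ℝ => solC' α θ φ T x)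
      (-qC α θ x * solC α θ φ T x) x :=
    fun x hx => (hT.hasDerivAt_solC' hφ hα hθ (ofReal_mem_sector hx)).comp_ofReal
  have hU0 : ∀ x : ℝ, 0 < x → solC α θ φ T x ≠ 0 := fun x hx => by
    have hz := ofReal_mem_sector (α := α) hx
    refine mul_ne_zero (mul_ne_zero (bC_ne_zero hα hθ hz) (Complex.exp_ne_zero _)) fun h0 => ?_
    have := hT.norm_sub_one_le hφ hα hθ hz
    rw [h0, zero_sub, norm_neg, norm_one] at this
    linarith
  set W : ℝ → ℂ := fun x => u' x * solC α θ φ T x - u x * solC' α θ φ T x with hW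
  have hWd : ∀ x, 0 < x → HasDerivAt W 0 x := fun x hx => by
    refine (((hu' x).mul (hU x hx)).sub ((hu x).mul (hV x hx))).congr_deriv ?_
    have : ((spd α θ x : ℂ))⁻¹ ^ 2 = qC α θ x := by
      rw [← sC_sq, sC_ofReal hθ hx]; push_cast; rfl
    rw [this]
    ring
  have hWlim : Tendsto W atTop (𝓝 0) := by
    obtain ⟨C, hC⟩ := hS.1
    have hd := hS.tendsto_volterraTail hα hθ hx₀
    have hinv : Tendsto (fun x : ℝ => 2 * (2 * α ^ 2 / x)) atTop (𝓝 0) := by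
      have := (tendsto_id.const_div_atTop (2 * α ^ 2)).const_mul 2
      rwa [mul_zero] at this
    have hbound : Tendsto (fun x : ℝ => 2 * (‖volterraTail α θ S x‖ * 2 +
        2 * (2 * α ^ 2 / x) * C)) atTop (𝓝 0) := by
      simpa using ((hd.norm.mul_const 2).add (hinv.mul_const C)).const_mul 2
    refine squeeze_zero_norm' ?_ hbound
    filter_upwards [eventually_gt_atTop x₀] with x hx
    have hx0 := hx₀.trans hx
    have hz := ofReal_mem_sector (α := α) hx0
    have hb := bC_ne_zero hα hθ hz
    have hWx : W x = 2 * Complex.I * (volterraTail α θ S x * T x -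
        tailOp α θ (expWeight φ) T x * S x) := by
      have he : Complex.exp (Complex.I * (phase α θ x : ℂ)) *
          Complex.exp (-Complex.I * (phase α θ x : ℂ)) = 1 := by
        rw [← Complex.exp_add, ← Complex.exp_zero]
        ring_nf
      simp only [hW, solC, solC', hφ.2 x hx0]
      rw [hS.deriv_eq hα hθ hx₀ (hu x) huS hx, huS x (le_of_lt hx), vminus,
        ← bC_ofReal hθ hx0]
      generalize volterraTail α θ S x = d
      generalize tailOp α θ (expWeight φ) T x = n
      generalize Complex.exp (Complex.I * (phase α θ x : ℂ)) = e at *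
      generalize Complex.exp (-Complex.I * (phase α θ x : ℂ)) = e' at *
      field_simp
      linear_combination (2 * Complex.I * (d * T x - S x * n)) * he
    rw [hWx, norm_mul, norm_mul, Complex.norm_I, mul_one, Complex.norm_ofNat]
    have h1 := hT.norm_le _ hz
    have h2 := norm_tailOp_le_div_re hα hθ (hφ.isWeight hα hθ) hT.norm_le hz
    have h3 := hC x (le_of_lt hx)
    rw [Complex.ofReal_re] at h2
    gcongr
    refine (norm_sub_le _ _).trans ?_
    rw [norm_mul, norm_mul]
    gcongr
  have hW0 : ∀ x, 0 < x → W x = 0 := fun x hx => by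
    refine tendsto_nhds_unique (tendsto_const_nhds (x := W x) (f := atTop)) (hWlim.congr' ?_)
    filter_upwards [eventually_gt_atTop 0] with y hy using eq_of_hasDerivAt_zero_Ioi hWd hy hx
  have hr : ∀ x, 0 < x → HasDerivAt (fun x : ℝ => u x / solC α θ φ T x) 0 x := fun x hx => by
    refine ((hu x).div (hU x hx) (hU0 x hx)).congr_deriv ?_
    have := hW0 x hx
    simp only [hW] at this
    rw [this, zero_div]
  have heq : ∀ x, 0 < x → u x = u 1 / solC α θ φ T (1 : ℝ) * solC α θ φ T x := fun x hx => by
    rw [← eq_of_hasDerivAt_zero_Ioi hr hx one_pos, div_mul_cancel₀ _ (hU0 x hx)]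
  refine ⟨u 1 / solC α θ φ T (1 : ℝ), fun h0 => ?_, fun x hx => ⟨heq x hx, ?_⟩⟩
  · have hS0 : ∀ x, x₀ ≤ x → S x = 0 := fun x hx => by
      have h1 := heq x (hx₀.trans_le hx)
      rw [h0, zero_mul, huS x hx] at h1
      exact (mul_eq_zero.1 h1).resolve_right (vminus_ne_zero hθ)
    have h2 := hS.2.2 x₀ self_mem_Ici
    have h3 : ∫ y in Ioi x₀, (Mfun α θ y : ℂ) * S y = 0 := by
      refine setIntegral_eq_zero_of_forall_eq_zero fun y hy => ?_
      rw [hS0 y (le_of_lt hy), mul_zero]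
    rw [Kop, intervalIntegral.integral_same, h3, hS0 x₀ le_rfl, add_zero, mul_zero,
      add_zero] at h2
    exact Complex.exp_ne_zero _ h2.symm
  · have h1 := hW0 x hx
    simp only [hW] at h1
    have h2 := hU0 x hx
    refine mul_right_cancel₀ h2 ?_
    rw [heq x hx] at h1
    linear_combination h1

end Matching

section Laplace

variable {α : ℝ}

lemma integrableOn_rpow_mul_exp_neg {s b : ℝ} (hs : 0 ≤ s) (hb : 0 < b) :
    IntegrableOn (fun t : ℝ => t ^ s * Real.exp (-(b * t))) (Ioi 0) := by
  have h := integrableOn_rpow_mul_exp_neg_mul_rpow (p := 1) (s := s) (b := b)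
    (by linarith) zero_lt_one hb
  simpa only [Real.rpow_one, neg_mul] using h

lemma norm_exp_neg_mul_ofReal (r : ℂ) (t : ℝ) :
    ‖Complex.exp (-(r * t))‖ = Real.exp (-(r.re * t)) := by
  rw [Complex.norm_exp, Complex.neg_re, Complex.re_mul_ofReal]

lemma hasDerivAt_laplace_rpow (hα : 1 ≤ α) {r : ℂ} (hr : 0 < r.re) :
    HasDerivAt (fun r : ℂ => ∫ t in Ioi (0:ℝ), ((t ^ α : ℝ) : ℂ) * Complex.exp (-(r * t)))
      (∫ t in Ioi (0:ℝ), -((t : ℂ) * ((t ^ α : ℝ) : ℂ) * Complex.exp (-(r * t)))) r := by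
  have hα0 : 0 ≤ α := by linarith
  have hcont : Continuous fun t : ℝ => ((t ^ α : ℝ) : ℂ) :=
    Complex.continuous_ofReal.comp (Real.continuous_rpow_const hα0)
  have hb : 0 < r.re / 2 := by linarith
  have hF : ∀ r : ℂ, Continuous fun t : ℝ => ((t ^ α : ℝ) : ℂ) * Complex.exp (-(r * t)) :=
    fun r => hcont.mul (by fun_prop)
  refine (hasDerivAt_integral_of_dominated_loc_of_deriv_le
    (μ := volume.restrict (Ioi (0:ℝ)))
    (F := fun (r : ℂ) (t : ℝ) => ((t ^ α : ℝ) : ℂ) * Complex.exp (-(r * t)))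
    (F' := fun (r : ℂ) (t : ℝ) => -((t : ℂ) * ((t ^ α : ℝ) : ℂ) * Complex.exp (-(r * t))))
    (bound := fun t : ℝ => t ^ (α + 1) * Real.exp (-(r.re / 2 * t)))
    (Metric.ball_mem_nhds r hb)
    (Eventually.of_forall fun r => (hF r).aestronglyMeasurable) ?_ ?_ ?_ ?_ ?_).2
  · refine (integrableOn_rpow_mul_exp_neg hα0 hr).mono' (hF r).aestronglyMeasurable ?_
    filter_upwards [ae_restrict_mem measurableSet_Ioi] with t ht
    rw [norm_mul, norm_exp_neg_mul_ofReal, Complex.norm_real,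
      Real.norm_of_nonneg (Real.rpow_nonneg (le_of_lt ht) _)]
  · exact (((Complex.continuous_ofReal.mul hcont).mul (by fun_prop)).neg).aestronglyMeasurable
  · filter_upwards [ae_restrict_mem measurableSet_Ioi] with t ht r' hr'
    have ht0 : 0 < t := ht
    have h1 : r.re / 2 ≤ r'.re := by
      have h2 := Complex.abs_re_le_norm (r' - r)
      rw [Metric.mem_ball, dist_eq_norm] at hr'
      rw [Complex.sub_re] at h2
      linarith [neg_abs_le (r'.re - r.re)]
    rw [norm_neg, norm_mul, norm_mul, norm_exp_neg_mul_ofReal, Complex.norm_real,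
      Complex.norm_real, Real.norm_of_nonneg (Real.rpow_nonneg ht0.le _),
      Real.norm_of_nonneg ht0.le, mul_comm t, ← Real.rpow_add_one ht0.ne']
    gcongr
  · exact integrableOn_rpow_mul_exp_neg (by linarith) hb
  · filter_upwards with t r' _
    have h1 : HasDerivAt (fun r : ℂ => -(r * t)) (-(1 * (t : ℂ))) r' :=
      ((hasDerivAt_id r').mul_const _).neg
    refine (h1.cexp.const_mul _).congr_deriv ?_
    ring

lemma integral_rpow_mul_cexp_neg_mul_Ioi (hα : 1 ≤ α) {r : ℂ} (hr : 0 < r.re) :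
    ∫ t in Ioi (0:ℝ), ((t ^ α : ℝ) : ℂ) * Complex.exp (-(r * t)) =
      (Real.Gamma (α + 1) : ℂ) * r ^ (-((α : ℂ) + 1)) := by
  have hopen : IsOpen {r : ℂ | 0 < r.re} := isOpen_lt continuous_const Complex.continuous_re
  have hconv : Convex ℝ {r : ℂ | 0 < r.re} := convex_halfSpace_re_gt 0
  have h1 : AnalyticOnNhd ℂ (fun r : ℂ =>
      ∫ t in Ioi (0:ℝ), ((t ^ α : ℝ) : ℂ) * Complex.exp (-(r * t))) {r : ℂ | 0 < r.re} :=
    DifferentiableOn.analyticOnNhd (fun r hr =>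
      (hasDerivAt_laplace_rpow hα hr).differentiableAt.differentiableWithinAt) hopen
  have h2 : AnalyticOnNhd ℂ (fun r : ℂ =>
      (Real.Gamma (α + 1) : ℂ) * r ^ (-((α : ℂ) + 1))) {r : ℂ | 0 < r.re} :=
    DifferentiableOn.analyticOnNhd (fun r hr =>
      ((differentiableAt_id.cpow_const (Or.inl hr)).const_mul _).differentiableWithinAt) hopen
  have hreal : ∀ ρ : ℝ, 0 < ρ →
      ∫ t in Ioi (0:ℝ), ((t ^ α : ℝ) : ℂ) * Complex.exp (-((ρ : ℂ) * t)) =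
        (Real.Gamma (α + 1) : ℂ) * (ρ : ℂ) ^ (-((α : ℂ) + 1)) := fun ρ hρ => by
    have ha : (0:ℝ) < ((α : ℂ) + 1).re := by
      rw [Complex.add_re, Complex.ofReal_re, Complex.one_re]; linarith
    have h3 := Complex.integral_cpow_mul_exp_neg_mul_Ioi ha hρ
    rw [add_sub_cancel_right, one_div, Complex.inv_cpow _ _
      (by rw [Complex.arg_ofReal_of_nonneg hρ.le]; exact Real.pi_pos.ne), ← Complex.cpow_neg,
      mul_comm, ← Complex.ofReal_one, ← Complex.ofReal_add, Complex.Gamma_ofReal] at h3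
    rw [← Complex.ofReal_one, ← Complex.ofReal_add, ← h3]
    refine setIntegral_congr_fun measurableSet_Ioi fun t ht => ?_
    simp only [Complex.ofReal_cpow (le_of_lt ht)]
  refine h1.eqOn_of_preconnected_of_frequently_eq h2 hconv.isPreconnected
    (z₀ := 1) (by simp) ?_ hr
  have ht : Tendsto (fun ρ : ℝ => (ρ : ℂ)) (𝓝[>] 1) (𝓝[≠] 1) := by
    refine tendsto_nhdsWithin_iff.2 ⟨?_, ?_⟩
    · have := (Complex.continuous_ofReal.tendsto 1).mono_left (nhdsWithin_le_nhds (s := Ioi 1))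
      simpa using this
    · filter_upwards [self_mem_nhdsWithin] with ρ hρ h
      exact (ne_of_gt hρ) (by simpa using h)
  refine ht.frequently (Eventually.frequently ?_)
  filter_upwards [self_mem_nhdsWithin] with ρ hρ
  exact hreal ρ (one_pos.trans hρ)

lemma integral_ray (hα : 1 ≤ α) :
    ∫ τ in Ioi (0:ℝ), ((τ : ℂ) * dir α) ^ (α : ℂ) *
        Complex.exp (-2 * Complex.I * ((τ : ℂ) * dir α)) * dir α =
      (Real.Gamma (α + 1) : ℂ) / (2 * Complex.I) ^ ((α : ℂ) + 1) := by
  have hα0 : 0 < α := by linarith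
  have hd : dir α ≠ 0 := fun h => by
    have := congrArg Complex.re h
    simp at this
  have hI : (2 * Complex.I) ≠ 0 := mul_ne_zero two_ne_zero Complex.I_ne_zero
  have hre : 0 < (2 * Complex.I * dir α).re := by
    simp [Complex.mul_re]
    positivity
  have harg : (2 * Complex.I).arg + (dir α).arg ∈ Ioc (-Real.pi) Real.pi := by
    have h1 : (2 * Complex.I).arg = Real.pi / 2 := by
      have := Complex.arg_real_mul Complex.I (r := 2) two_pos
      rw [Complex.arg_I] at this
      exact_mod_cast this
    have h2 : |(dir α).arg| < Real.pi / 2 := Complex.abs_arg_lt_pi_div_two_iff.2 (Or.inl (by simp))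
    rw [abs_lt] at h2
    rw [h1]
    constructor <;> linarith [Real.pi_pos]
  have hpow : (2 * Complex.I * dir α) ^ (-((α : ℂ) + 1)) =
      (2 * Complex.I) ^ (-((α : ℂ) + 1)) * dir α ^ (-((α : ℂ) + 1)) := by
    rw [Complex.cpow_def_of_ne_zero (mul_ne_zero hI hd), Complex.cpow_def_of_ne_zero hI,
      Complex.cpow_def_of_ne_zero hd, (Complex.log_mul_eq_add_log_iff hI hd).2 harg, add_mul,
      Complex.exp_add]
  calc _ = ∫ τ in Ioi (0:ℝ), (dir α ^ ((α : ℂ) + 1)) *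
        (((τ ^ α : ℝ) : ℂ) * Complex.exp (-((2 * Complex.I * dir α) * τ))) := by
        refine setIntegral_congr_fun measurableSet_Ioi fun τ hτ => ?_
        have hτ' : (0:ℝ) < τ := hτ
        have h1 : ((τ : ℂ) * dir α) ^ (α : ℂ) = ((τ ^ α : ℝ) : ℂ) * dir α ^ (α : ℂ) := by
          have hτ0 : (τ : ℂ) ≠ 0 := Complex.ofReal_ne_zero.2 hτ'.ne'
          rw [Complex.ofReal_cpow hτ'.le, Complex.cpow_def_of_ne_zero (mul_ne_zero hτ0 hd),
            Complex.cpow_def_of_ne_zero hτ0, Complex.cpow_def_of_ne_zero hd,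
            Complex.log_ofReal_mul hτ' hd, Complex.ofReal_log hτ'.le, add_mul, Complex.exp_add]
        simp only [h1, Complex.cpow_add _ _ hd, Complex.cpow_one]
        ring_nf
    _ = _ := by
        rw [integral_const_mul, integral_rpow_mul_cexp_neg_mul_Ioi hα hre, hpow,
          Complex.cpow_neg, Complex.cpow_neg]
        have h3 : dir α ^ ((α : ℂ) + 1) ≠ 0 := by simp [Complex.cpow_eq_zero_iff, hd]
        field_simp

end Laplace

section RayIntegral

variable {α θ x τ : ℝ} {φ T : ℂ → ℂ} {z : ℂ}

lemma tendsto_one_add_rpow_mul_exp (s : ℝ) {b : ℝ} (hb : 0 < b) :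
    Tendsto (fun τ : ℝ => (1 + 2 * τ) ^ s * Real.exp (-(b * τ))) atTop (𝓝 0) := by
  have h1 := tendsto_rpow_mul_exp_neg_mul_atTop_nhds_zero s (b / 2) (by positivity)
  have h2 : Tendsto (fun τ : ℝ => 1 + 2 * τ) atTop atTop :=
    tendsto_atTop_add_const_left _ _ (tendsto_id.const_mul_atTop two_pos)
  have h3 := (h1.comp h2).mul_const (Real.exp (b / 2))
  rw [zero_mul] at h3
  refine h3.congr fun τ => ?_
  rw [Function.comp_apply, mul_assoc, ← Real.exp_add]
  ring_nf

lemma integrableOn_one_add_rpow_mul_exp {s b : ℝ} (hs : 0 ≤ s) (hb : 0 < b) :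
    IntegrableOn (fun τ : ℝ => (1 + 2 * τ) ^ s * Real.exp (-(b * τ))) (Ioi 0) := by
  have hb2 : 0 < b / 2 := by positivity
  have hc : Continuous fun τ : ℝ => (1 + 2 * τ) ^ s * Real.exp (-(b * τ)) :=
    ((by fun_prop : Continuous fun τ : ℝ => 1 + 2 * τ).rpow_const fun _ => Or.inr hs).mul
      (by fun_prop)
  refine integrable_of_isBigO_exp_neg hb2 hc.continuousOn ?_
  have h1 := ((tendsto_one_add_rpow_mul_exp s hb2).isBigO_one ℝ).mul
    (Asymptotics.isBigO_refl (fun τ : ℝ => Real.exp (-(b / 2) * τ)) atTop)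
  refine h1.congr (fun τ => ?_) fun τ => one_mul _
  rw [mul_assoc, ← Real.exp_add]
  ring_nf

lemma norm_add_mul_dir_rpow_le (hα : 1 ≤ α) {s : ℝ} (hs : 0 ≤ s) (hx : 0 < x) (hx1 : x ≤ 1)
    (hτ : 0 ≤ τ) : ‖(x + τ * dir α : ℂ)‖ ^ s ≤ (1 + 2 * τ) ^ s := by
  have := norm_add_mul_dir_le hα hx hτ
  gcongr
  linarith

lemma one_le_one_add_rpow {s : ℝ} (hs : 0 ≤ s) (hτ : 0 ≤ τ) : 1 ≤ (1 + 2 * τ) ^ s :=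
  Real.one_le_rpow (by linarith) hs

lemma norm_exp_neg_I_mul_le_one (hα : 1 ≤ α) (x : ℝ) (hτ : 0 ≤ τ) :
    ‖Complex.exp (-Complex.I * (x + τ * dir α))‖ ≤ 1 := by
  refine (norm_exp_neg_I_mul_le hα x hτ).trans (Real.exp_le_one_iff.2 ?_)
  rw [neg_nonpos]
  positivity

namespace IsAmplitude

lemma norm_solC_le (hT : IsAmplitude α θ φ T) (hφ : IsPhase α θ φ) (hα : 1 ≤ α) (hθ : 0 < θ)
    (hx : 0 < x) (hτ : 0 ≤ τ) :
    ‖solC α θ φ T (x + τ * dir α)‖ ≤ 2 * Real.exp (-(τ / (2 * α))) := by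
  have hz := add_dir_mem_sector hα (ofReal_mem_sector hx) hτ
  have h1 := norm_bC_le hα hθ hz
  have h2 := hφ.norm_exp_le hα hθ hx hτ
  have h3 := hT.norm_le _ hz
  rw [solC, norm_mul, norm_mul]
  calc _ ≤ 1 * Real.exp (-(τ / (2 * α))) * 2 := by gcongr
    _ = _ := by ring

lemma norm_solC'_le (hT : IsAmplitude α θ φ T) (hφ : IsPhase α θ φ) (hα : 1 ≤ α) (hθ : 0 < θ)
    (hl : cM α * θ ^ (1 / α) ≤ 1 / 4) (hx : 0 < x) (hx1 : x ≤ 1) (hτ : 0 ≤ τ) :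
    ‖solC' α θ φ T (x + τ * dir α)‖ ≤
      (2 * (α * θ / x) + 3 * (1 + θ)) * ((1 + 2 * τ) ^ α * Real.exp (-(τ / (2 * α)))) := by
  have hα0 : 0 ≤ α := by linarith
  have hz := add_dir_mem_sector hα (ofReal_mem_sector hx) hτ
  have hy := norm_add_mul_dir_rpow_le hα hα0 hx hx1 hτ
  have hy1 := one_le_one_add_rpow hα0 hτ
  have h2 := hφ.norm_exp_le hα hθ hx hτ
  have h3 := hT.norm_le _ hz
  have h4 := norm_tailOp_le hα hθ (hφ.isWeight hα hθ) hT.norm_le hz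
  have hq1 := one_le_norm_qC hα hθ hz
  have hb1 := norm_bC_le hα hθ hz
  have hb0 := bC_ne_zero hα hθ hz
  have hb4 := congrArg norm (bC_pow_four (α := α) (θ := θ) (z := x + τ * dir α))
  have hq' := norm_qC' hα hθ hz
  have hzx : x ≤ ‖(x + τ * dir α : ℂ)‖ := by
    refine le_trans ?_ (Complex.re_le_norm _)
    simp [Complex.mul_re, hτ]
  generalize hze : (x + τ * dir α : ℂ) = z at *
  have hq : ‖qC α θ z‖ ≤ 1 + θ * (1 + 2 * τ) ^ α := by
    rw [qC]
    refine (norm_add_le _ _).trans ?_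
    rw [norm_one, norm_mul, Complex.norm_real, Complex.norm_cpow_real, Real.norm_of_nonneg hθ.le]
    gcongr
  have hbinv : ‖(bC α θ z)⁻¹‖ ≤ 1 + θ * (1 + 2 * τ) ^ α := by
    refine le_trans ?_ hq
    rw [norm_pow, norm_inv] at hb4
    have h5 : 1 ≤ ‖(bC α θ z)⁻¹‖ := by
      rw [norm_inv]; exact (one_le_inv₀ (norm_pos_iff.2 hb0)).2 hb1
    have h6 : ‖(bC α θ z)⁻¹‖ ^ 4 = ‖qC α θ z‖ := by
      rw [norm_inv, inv_pow, hb4, inv_inv]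
    rw [← h6]
    exact le_self_pow₀ h5 (by norm_num)
  have hb' : ‖bC' α θ z‖ ≤ α * θ / x * (1 + 2 * τ) ^ α := by
    have h7 : ‖bC' α θ z‖ ≤ ‖qC' α θ z‖ := by
      rw [bC', norm_mul, norm_div, norm_mul]
      have h8 : ‖(-(1 / 4) : ℂ)‖ ≤ 1 := by norm_num
      calc _ ≤ 1 * (‖qC' α θ z‖ * 1 / 1) := by gcongr
        _ = _ := by ring
    refine h7.trans ?_
    rw [hq']
    calc _ ≤ α * (θ * (1 + 2 * τ) ^ α) / x := by gcongr
      _ = _ := by ring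
  have hin : ‖-Complex.I * T z + 2 * Complex.I * tailOp α θ (expWeight φ) T z‖ ≤ 3 := by
    refine (norm_add_le _ _).trans ?_
    simp only [norm_mul, norm_neg, Complex.norm_I, Complex.norm_ofNat]
    linarith
  rw [solC', norm_mul]
  calc _ ≤ Real.exp (-(τ / (2 * α))) * (α * θ / x * (1 + 2 * τ) ^ α * 2 +
        (1 + θ * (1 + 2 * τ) ^ α) * 3) := by
        gcongr
        refine (norm_add_le _ _).trans ?_
        rw [norm_mul, norm_mul]
        gcongr
    _ ≤ Real.exp (-(τ / (2 * α))) * (α * θ / x * (1 + 2 * τ) ^ α * 2 +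
        ((1 + 2 * τ) ^ α + θ * (1 + 2 * τ) ^ α) * 3) := by gcongr
    _ = _ := by ring

end IsAmplitude

/-- The combination `(dU/dz + iU) e^(-iz)` of `U = solC`, which isolates its reflected part. -/
def solE (α θ : ℝ) (φ T : ℂ → ℂ) (z : ℂ) : ℂ :=
  (solC' α θ φ T z + Complex.I * solC α θ φ T z) * Complex.exp (-Complex.I * z)

namespace IsAmplitude

lemma hasDerivAt_solE (hT : IsAmplitude α θ φ T) (hφ : IsPhase α θ φ) (hα : 1 ≤ α)
    (hθ : 0 < θ) (hz : z ∈ sector α) :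
    HasDerivAt (solE α θ φ T)
      (-(θ * (z ^ (α : ℂ) * solC α θ φ T z * Complex.exp (-Complex.I * z)))) z := by
  have h1 : HasDerivAt (fun z : ℂ => -Complex.I * z) (-Complex.I * 1) z :=
    (hasDerivAt_id z).const_mul _
  refine (((hT.hasDerivAt_solC' hφ hα hθ hz).add
    ((hT.hasDerivAt_solC hφ hα hθ hz).const_mul Complex.I)).mul h1.cexp).congr_deriv ?_
  simp only [qC, Pi.add_apply]
  linear_combination (-solC α θ φ T z * Complex.exp (-Complex.I * z)) * Complex.I_mul_I

lemma tendsto_solE (hT : IsAmplitude α θ φ T) (hφ : IsPhase α θ φ) (hα : 1 ≤ α) (hθ : 0 < θ)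
    (hl : cM α * θ ^ (1 / α) ≤ 1 / 4) (hx : 0 < x) (hx1 : x ≤ 1) :
    Tendsto (fun τ : ℝ => solE α θ φ T (x + τ * dir α)) atTop (𝓝 0) := by
  have hα0 : 0 < α := by linarith
  have h1 := (tendsto_one_add_rpow_mul_exp α (b := 1 / (2 * α)) (by positivity)).const_mul
    (2 * (α * θ / x) + 3 * (1 + θ) + 2)
  rw [mul_zero] at h1
  refine squeeze_zero_norm' ?_ h1
  filter_upwards [eventually_ge_atTop 0] with τ hτ
  have h2 := hT.norm_solC'_le hφ hα hθ hl hx hx1 hτ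
  have h3 := hT.norm_solC_le hφ hα hθ hx hτ
  have h4 := norm_exp_neg_I_mul_le_one hα x hτ
  have h5 := one_le_one_add_rpow hα0.le hτ
  have h6 : 1 / (2 * α) * τ = τ / (2 * α) := by ring
  rw [solE, norm_mul, h6]
  calc _ ≤ ((2 * (α * θ / x) + 3 * (1 + θ)) * ((1 + 2 * τ) ^ α * Real.exp (-(τ / (2 * α)))) +
        2 * (1 * Real.exp (-(τ / (2 * α))))) * 1 := by
        gcongr
        refine (norm_add_le _ _).trans ?_
        rw [norm_mul, Complex.norm_I, one_mul]
        linarith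
    _ ≤ ((2 * (α * θ / x) + 3 * (1 + θ)) * ((1 + 2 * τ) ^ α * Real.exp (-(τ / (2 * α)))) +
        2 * ((1 + 2 * τ) ^ α * Real.exp (-(τ / (2 * α))))) * 1 := by gcongr
    _ = _ := by ring

lemma continuousOn_solC (hT : IsAmplitude α θ φ T) (hφ : IsPhase α θ φ) (hα : 1 ≤ α)
    (hθ : 0 < θ) : ContinuousOn (solC α θ φ T) (sector α) :=
  fun _ hz => (hT.hasDerivAt_solC hφ hα hθ hz).continuousAt.continuousWithinAt

end IsAmplitude

lemma continuousOn_cpow_sector (hα : 1 ≤ α) :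
    ContinuousOn (fun z : ℂ => z ^ (α : ℂ)) (sector α) :=
  fun _ hz => (continuousAt_cpow_const
    (mem_slitPlane_of_mem_sector hα hz)).continuousWithinAt

/-- A function on the sector bounded by `C e^(-τ/(2α))` along rays gives an integrable ray
integrand against `z^α e^(-iz)`. -/
lemma integrableOn_ray (hα : 1 ≤ α) (hx : 0 < x) (hx1 : x ≤ 1) {g : ℂ → ℂ}
    (hg : ContinuousOn g (sector α)) {C : ℝ}
    (hb : ∀ τ : ℝ, 0 ≤ τ → ‖g (x + τ * dir α)‖ ≤ C * Real.exp (-(τ / (2 * α)))) :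
    IntegrableOn (fun τ : ℝ => ((x + τ * dir α : ℂ) ^ (α : ℂ) * g (x + τ * dir α) *
      Complex.exp (-Complex.I * (x + τ * dir α))) * dir α) (Ioi 0) := by
  have hα0 : 0 < α := by linarith
  have hc : ContinuousOn (fun z : ℂ => z ^ (α : ℂ) * g z * Complex.exp (-Complex.I * z))
      (sector α) := ((continuousOn_cpow_sector hα).mul hg).mul (by fun_prop)
  refine Integrable.mono' (((integrableOn_one_add_rpow_mul_exp hα0.le
    (b := 1 / (2 * α)) (by positivity)).const_mul C).mul_const ‖dir α‖)
    ((((continuousOn_comp_add_dir hα hc (ofReal_mem_sector hx)).mono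
      Ioi_subset_Ici_self).mul continuousOn_const).aestronglyMeasurable measurableSet_Ioi) ?_
  filter_upwards [ae_restrict_mem measurableSet_Ioi] with τ hτ
  have hτ0 : 0 ≤ τ := le_of_lt hτ
  have h1 := norm_add_mul_dir_rpow_le hα hα0.le hx hx1 hτ0
  have h2 := hb τ hτ0
  have h3 := norm_exp_neg_I_mul_le_one hα x hτ0
  have h6 : 1 / (2 * α) * τ = τ / (2 * α) := by ring
  rw [norm_mul, norm_mul, norm_mul, Complex.norm_cpow_real, h6]
  refine mul_le_mul_of_nonneg_right ?_ (norm_nonneg _)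
  have h7 : 0 ≤ C * Real.exp (-(τ / (2 * α))) := (norm_nonneg _).trans h2
  calc _ ≤ (1 + 2 * τ) ^ α * (C * Real.exp (-(τ / (2 * α)))) * 1 := by gcongr
    _ = _ := by ring

lemma IsAmplitude.solE_eq_integral (hT : IsAmplitude α θ φ T) (hφ : IsPhase α θ φ) (hα : 1 ≤ α)
    (hθ : 0 < θ) (hl : cM α * θ ^ (1 / α) ≤ 1 / 4) (hx : 0 < x) (hx1 : x ≤ 1) :
    solE α θ φ T x = θ * ∫ τ in Ioi (0:ℝ), ((x + τ * dir α : ℂ) ^ (α : ℂ) *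
      solC α θ φ T (x + τ * dir α) * Complex.exp (-Complex.I * (x + τ * dir α))) * dir α := by
  have hd : ∀ τ : ℝ, 0 ≤ τ → HasDerivAt (fun τ : ℝ => solE α θ φ T (x + τ * dir α))
      (-(θ * (((x + τ * dir α : ℂ) ^ (α : ℂ) *
      solC α θ φ T (x + τ * dir α) * Complex.exp (-Complex.I * (x + τ * dir α))) * dir α))) τ :=
    fun τ hτ => by
      have hz := add_dir_mem_sector hα (ofReal_mem_sector hx) hτ
      refine ((hT.hasDerivAt_solE hφ hα hθ hz).comp τ
        (hasDerivAt_add_dir α x τ)).congr_deriv ?_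
      ring
  have h := integral_Ioi_of_hasDerivAt_of_tendsto (a := 0)
    (hd 0 le_rfl).continuousAt.continuousWithinAt (fun τ hτ => hd τ (le_of_lt hτ))
    (((integrableOn_ray hα hx hx1 (hT.continuousOn_solC hφ hα hθ)
      fun τ hτ => hT.norm_solC_le hφ hα hθ hx hτ).const_mul _).neg)
    (hT.tendsto_solE hφ hα hθ hl hx hx1)
  rw [integral_neg, integral_const_mul, Complex.ofReal_zero, zero_mul, add_zero, zero_sub,
    neg_inj] at h
  exact h.symm

end RayIntegral

section RayError

variable {α θ x τ : ℝ} {φ T : ℂ → ℂ}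

lemma le_rpow_one_div (hα : 1 ≤ α) (hθ : 0 < θ) (hθ1 : θ ≤ 1) : θ ≤ θ ^ (1 / α) := by
  have h : 1 / α ≤ 1 := by rw [div_le_one (by positivity)]; exact hα
  simpa using Real.rpow_le_rpow_of_exponent_ge hθ hθ1 h

lemma norm_exp_sub_exp_le {a b : ℂ} (ha : a.re ≤ 0) (hb : b.re ≤ 0) :
    ‖Complex.exp a - Complex.exp b‖ ≤ ‖a - b‖ := by
  have h := (convex_halfSpace_re_le 0).norm_image_sub_le_of_norm_hasDerivWithin_le
    (f := Complex.exp) (f' := Complex.exp) (C := 1)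
    (fun z _ => (Complex.hasDerivAt_exp z).hasDerivWithinAt)
    (fun z hz => by rw [Complex.norm_exp]; exact Real.exp_le_one_iff.2 hz) hb ha
  simpa using h

lemma IsAmplitude.norm_solC_sub_le (hT : IsAmplitude α θ φ T) (hφ : IsPhase α θ φ) (hα : 1 ≤ α)
    (hθ : 0 < θ) (hθ1 : θ ≤ 1) (hx : 0 < x) (hx1 : x ≤ 1) (hτ : 0 ≤ τ) :
    ‖solC α θ φ T (x + τ * dir α) - Complex.exp (-Complex.I * (x + τ * dir α))‖ ≤
      (4 * cM α + 2) * θ ^ (1 / α) * (1 + 2 * τ) ^ (α + 1) := by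
  have hα0 : 0 ≤ α := by linarith
  have hz := add_dir_mem_sector hα (ofReal_mem_sector hx) hτ
  have hy := norm_add_mul_dir_rpow_le hα hα0 hx hx1 hτ
  have hy1 : (1 : ℝ) ≤ (1 + 2 * τ) ^ (α + 1) := one_le_one_add_rpow (by linarith) hτ
  have hyy : (1 + 2 * τ) ^ α ≤ (1 + 2 * τ) ^ (α + 1) :=
    Real.rpow_le_rpow_of_exponent_le (by linarith) (by linarith)
  have hθα := le_rpow_one_div hα hθ hθ1
  have hc := (cM_pos hα).le
  have hτα : -(τ / (2 * α)) ≤ 0 := by rw [neg_nonpos]; positivity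
  have h1 := hφ.norm_exp_le hα hθ hx hτ
  have h2 := norm_exp_neg_I_mul_le hα x hτ
  have h3 := norm_exp_sub_exp_le
    (by rw [Complex.norm_exp, Real.exp_le_exp] at h1; exact h1.trans hτα)
    (by rw [Complex.norm_exp, Real.exp_le_exp] at h2; exact h2.trans hτα)
  have h4 := hφ.norm_sub_le hα hθ hx hτ
  have h5 : (x + 2 * τ) ^ (α + 1) ≤ (1 + 2 * τ) ^ (α + 1) := by gcongr
  rw [← mul_sub, norm_mul, norm_neg, Complex.norm_I, one_mul] at h3
  have h6 := hT.norm_sub_one_le hφ hα hθ hz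
  have h7 := norm_bC_sub_one_le hα hθ hz
  have h8 := norm_bC_le hα hθ hz
  have h9 := h1.trans (Real.exp_le_one_iff.2 hτα)
  generalize (x + τ * dir α : ℂ) = z at *
  have key : solC α θ φ T z - Complex.exp (-Complex.I * z) =
      Complex.exp (-Complex.I * φ z) * (bC α θ z * (T z - 1) + (bC α θ z - 1)) +
        (Complex.exp (-Complex.I * φ z) - Complex.exp (-Complex.I * z)) := by
    rw [solC]; ring
  rw [key]
  calc _ ≤ 1 * (1 * (4 * (cM α * θ ^ (1 / α))) + θ * (1 + 2 * τ) ^ α) +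
        θ * (x + 2 * τ) ^ (α + 1) := by
        refine (norm_add_le _ _).trans (add_le_add ?_ (h3.trans h4))
        rw [norm_mul]
        refine mul_le_mul h9 ((norm_add_le _ _).trans (add_le_add ?_ ?_)) (norm_nonneg _)
          zero_le_one
        · rw [norm_mul]
          gcongr
        · refine h7.trans ?_
          gcongr
    _ ≤ 1 * (1 * (4 * (cM α * θ ^ (1 / α)) * (1 + 2 * τ) ^ (α + 1)) +
        θ ^ (1 / α) * (1 + 2 * τ) ^ (α + 1)) + θ ^ (1 / α) * (1 + 2 * τ) ^ (α + 1) := by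
        have h10 := le_mul_of_one_le_right
          (by positivity : 0 ≤ 4 * (cM α * θ ^ (1 / α))) hy1
        have h11 : θ * (1 + 2 * τ) ^ α ≤ θ ^ (1 / α) * (1 + 2 * τ) ^ (α + 1) := by gcongr
        have h12 : θ * (x + 2 * τ) ^ (α + 1) ≤ θ ^ (1 / α) * (1 + 2 * τ) ^ (α + 1) := by gcongr
        linarith
    _ = _ := by ring

lemma norm_exp_neg_I_mul_le_one_mul (hα : 1 ≤ α) (x : ℝ) (hτ : 0 ≤ τ) :
    ‖Complex.exp (-Complex.I * (x + τ * dir α))‖ ≤ 1 * Real.exp (-(τ / (2 * α))) := by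
  rw [one_mul]
  exact norm_exp_neg_I_mul_le hα x hτ

/-- The constant in the first-order approximation of `solE`. -/
def cE (α : ℝ) : ℝ := (4 * cM α + 2) * 2 *
  ∫ τ in Ioi (0:ℝ), (1 + 2 * τ) ^ (2 * α + 1) * Real.exp (-(1 / (2 * α) * τ))

lemma cE_nonneg (hα : 1 ≤ α) : 0 ≤ cE α := by
  have hc := (cM_pos hα).le
  refine mul_nonneg (by positivity) (setIntegral_nonneg measurableSet_Ioi fun τ hτ => ?_)
  have : (0:ℝ) < τ := hτ
  positivity

lemma IsAmplitude.norm_solE_sub_le (hT : IsAmplitude α θ φ T) (hφ : IsPhase α θ φ) (hα : 1 ≤ α)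
    (hθ : 0 < θ) (hθ1 : θ ≤ 1) (hl : cM α * θ ^ (1 / α) ≤ 1 / 4) (hx : 0 < x) (hx1 : x ≤ 1) :
    ‖solE α θ φ T x - θ * ∫ τ in Ioi (0:ℝ), ((x + τ * dir α : ℂ) ^ (α : ℂ) *
      Complex.exp (-Complex.I * (x + τ * dir α)) *
      Complex.exp (-Complex.I * (x + τ * dir α))) * dir α‖ ≤ θ * (cE α * θ ^ (1 / α)) := by
  have hα0 : 0 < α := by linarith
  rw [hT.solE_eq_integral hφ hα hθ hl hx hx1, ← mul_sub, ← integral_sub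
    (integrableOn_ray hα hx hx1 (hT.continuousOn_solC hφ hα hθ)
      fun τ hτ => hT.norm_solC_le hφ hα hθ hx hτ)
    (integrableOn_ray (g := fun z => Complex.exp (-Complex.I * z)) hα hx hx1 (by fun_prop)
      fun τ hτ => norm_exp_neg_I_mul_le_one_mul hα x hτ),
    norm_mul, Complex.norm_real, Real.norm_of_nonneg hθ.le]
  refine mul_le_mul_of_nonneg_left ?_ hθ.le
  have hint := (integrableOn_one_add_rpow_mul_exp (s := 2 * α + 1) (b := 1 / (2 * α))
    (by linarith) (by positivity)).const_mul ((4 * cM α + 2) * 2 * θ ^ (1 / α))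
  refine (norm_integral_le_of_norm_le hint ?_).trans (le_of_eq ?_)
  · filter_upwards [ae_restrict_mem measurableSet_Ioi] with τ hτ
    have hτ0 : 0 ≤ τ := le_of_lt hτ
    have h1 := hT.norm_solC_sub_le hφ hα hθ hθ1 hx hx1 hτ0
    have h2 := norm_exp_neg_I_mul_le hα x hτ0
    have h3 := norm_add_mul_dir_rpow_le hα hα0.le hx hx1 hτ0
    have h4 := norm_dir_le hα
    have h5 : (1 + 2 * τ) ^ (2 * α + 1) = (1 + 2 * τ) ^ α * (1 + 2 * τ) ^ (α + 1) := by
      rw [← Real.rpow_add (by linarith)]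
      ring_nf
    have h6 : 1 / (2 * α) * τ = τ / (2 * α) := by ring
    rw [← sub_mul, ← sub_mul, ← mul_sub, norm_mul, norm_mul, norm_mul, Complex.norm_cpow_real, h5,
      h6]
    have hc := (cM_pos hα).le
    calc _ ≤ (1 + 2 * τ) ^ α * ((4 * cM α + 2) * θ ^ (1 / α) * (1 + 2 * τ) ^ (α + 1)) *
          Real.exp (-(τ / (2 * α))) * 2 := by gcongr
      _ = _ := by ring
  · rw [integral_const_mul, cE]
    ring

lemma tendsto_integral_ray (hα : 1 ≤ α) :
    Tendsto (fun x : ℝ => ∫ τ in Ioi (0:ℝ), ((x + τ * dir α : ℂ) ^ (α : ℂ) *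
      Complex.exp (-Complex.I * (x + τ * dir α)) *
      Complex.exp (-Complex.I * (x + τ * dir α))) * dir α) (𝓝[>] 0)
      (𝓝 ((Real.Gamma (α + 1) : ℂ) / (2 * Complex.I) ^ ((α : ℂ) + 1))) := by
  have hα0 : 0 < α := by linarith
  have h1 := integral_ray hα
  rw [← h1]
  have hx01 : ∀ᶠ x : ℝ in 𝓝[>] 0, 0 < x ∧ x ≤ 1 := by
    filter_upwards [Ioc_mem_nhdsGT (zero_lt_one' ℝ)] with x hx using hx
  refine tendsto_integral_filter_of_dominated_convergence
    (fun τ => (1 + 2 * τ) ^ α * Real.exp (-(1 / (2 * α) * τ)) * 2) ?_ ?_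
    ((integrableOn_one_add_rpow_mul_exp hα0.le (by positivity)).mul_const 2) ?_
  · filter_upwards [hx01] with x hx
    exact (integrableOn_ray (g := fun z => Complex.exp (-Complex.I * z)) hα hx.1 hx.2
      (by fun_prop) fun τ hτ => norm_exp_neg_I_mul_le_one_mul hα x hτ).aestronglyMeasurable
  · filter_upwards [hx01] with x hx
    filter_upwards [ae_restrict_mem measurableSet_Ioi] with τ hτ
    have hτ0 : 0 ≤ τ := le_of_lt hτ
    have h2 := norm_exp_neg_I_mul_le hα x hτ0
    have h2' := norm_exp_neg_I_mul_le_one hα x hτ0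
    have h3 := norm_add_mul_dir_rpow_le hα hα0.le hx.1 hx.2 hτ0
    have h4 := norm_dir_le hα
    have h6 : 1 / (2 * α) * τ = τ / (2 * α) := by ring
    rw [norm_mul, norm_mul, norm_mul, Complex.norm_cpow_real, h6]
    calc _ ≤ (1 + 2 * τ) ^ α * 1 * Real.exp (-(τ / (2 * α))) * 2 := by gcongr
      _ = _ := by ring
  · filter_upwards [ae_restrict_mem measurableSet_Ioi] with τ hτ
    have hτ0 : (0:ℝ) < τ := hτ
    have hmem : (((0:ℝ) : ℂ) + τ * dir α) ∈ Complex.slitPlane := by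
      refine Or.inl ?_
      simpa [Complex.mul_re] using hτ0
    have hc : ContinuousAt (fun x : ℝ => ((x + τ * dir α : ℂ) ^ (α : ℂ) *
      Complex.exp (-Complex.I * (x + τ * dir α)) *
      Complex.exp (-Complex.I * (x + τ * dir α))) * dir α) 0 := by
      have h0 : ContinuousAt (fun x : ℝ => (x + τ * dir α : ℂ)) 0 := by fun_prop
      have h1 : ContinuousAt (fun x : ℝ => Complex.exp (-Complex.I * (x + τ * dir α))) 0 := by
        fun_prop
      exact (((ContinuousAt.cpow h0 continuousAt_const hmem).mul h1).mul h1).mul_const _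
    have h2 := hc.tendsto.mono_left (nhdsWithin_le_nhds (s := Ioi 0))
    simp only [Complex.ofReal_zero, zero_add] at h2
    convert h2 using 2
    rw [mul_assoc (_ ^ _) (Complex.exp (-Complex.I * _)), ← Complex.exp_add]
    ring_nf

end RayError

section Connection

variable {α θ x₀ : ℝ}

lemma deriv_zero_of_eq_waves {u : ℝ → ℂ} {d A B : ℂ} (hu : HasDerivAt u d 0)
    (h : ∀ x : ℝ, x ≤ 0 → u x = B * Complex.exp (-Complex.I * (x : ℂ)) +
      A * Complex.exp (Complex.I * (x : ℂ))) :
    d = Complex.I * (A - B) := by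
  have h1 : HasDerivAt (fun x : ℂ => B * Complex.exp (-Complex.I * x) +
      A * Complex.exp (Complex.I * x)) (Complex.I * (A - B)) ((0:ℝ) : ℂ) := by
    refine ((((hasDerivAt_id _).const_mul (-Complex.I)).cexp.const_mul B).add
      (((hasDerivAt_id _).const_mul Complex.I).cexp.const_mul A)).congr_deriv ?_
    simp
    ring
  exact (uniqueDiffWithinAt_Iic (0:ℝ)).eq_deriv _ hu.hasDerivWithinAt
    (h1.comp_ofReal.hasDerivWithinAt.congr h (h 0 le_rfl))

/-- The limit of `R / θ` as `θ → 0`. -/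
def bornCoeff (α : ℝ) : ℂ := (Real.Gamma (α + 1) : ℂ) / (2 * Complex.I) ^ ((α : ℂ) + 2)

lemma two_I_mul_bornCoeff (α : ℝ) : 2 * Complex.I * bornCoeff α =
    (Real.Gamma (α + 1) : ℂ) / (2 * Complex.I) ^ ((α : ℂ) + 1) := by
  have h0 : 2 * Complex.I ≠ 0 := mul_ne_zero two_ne_zero Complex.I_ne_zero
  have h1 : (α : ℂ) + 2 = (α : ℂ) + 1 + 1 := by ring
  have h2 : (2 * Complex.I) ^ ((α : ℂ) + 1) ≠ 0 := by
    rw [Complex.cpow_def_of_ne_zero h0]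
    exact Complex.exp_ne_zero _
  rw [bornCoeff, h1, Complex.cpow_add _ _ h0, Complex.cpow_one]
  field_simp

/-- The normalized left-going and right-going coefficients are close to `θ * bornCoeff α`
and `1`. -/
lemma exists_normalized_coeffs (hα : 1 ≤ α) (hθ : 0 < θ) (hθ1 : θ ≤ 1)
    (hl : cM α * θ ^ (1 / α) ≤ 1 / 8) (hx₀ : 0 < x₀) {S : ℝ → ℂ} (hS : IsVolterraSol α θ x₀ S)
    {u u' : ℝ → ℂ} (hu : ∀ x : ℝ, HasDerivAt u (u' x) x)
    (hu' : ∀ x : ℝ, HasDerivAt u' (-((spd α θ x : ℂ))⁻¹ ^ 2 * u x) x)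
    (huS : ∀ x ∈ Ici x₀, u x = S x * vminus α θ x) {A B : ℂ}
    (hAB : ∀ x : ℝ, x ≤ 0 → u x = B * Complex.exp (-Complex.I * (x : ℂ)) +
      A * Complex.exp (Complex.I * (x : ℂ))) :
    ∃ l : ℂ, l ≠ 0 ∧ ‖A / l + B / l - 1‖ ≤ (4 * cM α + 2) * θ ^ (1 / α) ∧
      ‖A / l - θ * bornCoeff α‖ ≤ θ * (cE α * θ ^ (1 / α)) := by
  obtain ⟨φ, hφ⟩ := exists_isPhase hα hθ
  obtain ⟨T, hT⟩ := exists_isAmplitude hα hθ hφ (hl.trans (by norm_num))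
  obtain ⟨l, hl0, hul⟩ := exists_eq_mul_solC hα hθ hx₀ hφ hT (by linarith) hS hu hu' huS
  have hx01 : ∀ᶠ x : ℝ in 𝓝[>] 0, 0 < x ∧ x ≤ 1 := by
    filter_upwards [Ioc_mem_nhdsGT (zero_lt_one' ℝ)] with x hx using hx
  have hu0 : u 0 = B + A := by simpa using hAB 0 le_rfl
  have hu'0 : u' 0 = Complex.I * (A - B) := deriv_zero_of_eq_waves (hu 0) hAB
  have hlim : Tendsto u (𝓝[>] 0) (𝓝 (B + A)) := by
    rw [← hu0]
    exact (hu 0).continuousAt.tendsto.mono_left nhdsWithin_le_nhds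
  have hlim' : Tendsto u' (𝓝[>] 0) (𝓝 (Complex.I * (A - B))) := by
    rw [← hu'0]
    exact (hu' 0).continuousAt.tendsto.mono_left nhdsWithin_le_nhds
  have hexp : Tendsto (fun x : ℝ => Complex.exp (-Complex.I * (x : ℂ))) (𝓝[>] 0) (𝓝 1) := by
    have h1 : Continuous fun x : ℝ => Complex.exp (-Complex.I * (x : ℂ)) := by fun_prop
    have h2 := (h1.tendsto 0).mono_left (nhdsWithin_le_nhds (s := Ioi 0))
    simpa using h2
  refine ⟨l, hl0, ?_, ?_⟩
  · have h1 := ((hlim.div_const l).sub hexp).norm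
    rw [add_comm B, add_div] at h1
    refine le_of_tendsto h1 ?_
    filter_upwards [hx01] with x hx
    have h2 := hT.norm_solC_sub_le hφ hα hθ hθ1 hx.1 hx.2 le_rfl
    rw [(hul x hx.1).1, mul_div_cancel_left₀ _ hl0]
    simpa using h2
  · have h1 := ((((hlim'.add (hlim.const_mul Complex.I)).div_const l).mul hexp).sub
      ((tendsto_integral_ray hα).const_mul (θ : ℂ))).norm
    have h2 : (Complex.I * (A - B) + Complex.I * (B + A)) / l * 1 -
        θ * ((Real.Gamma (α + 1) : ℂ) / (2 * Complex.I) ^ ((α : ℂ) + 1)) =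
        2 * Complex.I * (A / l - θ * bornCoeff α) := by
      rw [← two_I_mul_bornCoeff]
      ring
    rw [h2, norm_mul] at h1
    have h3 : ‖(2 * Complex.I)‖ = 2 := by simp
    rw [h3] at h1
    have h4 := le_of_tendsto h1 (b := θ * (cE α * θ ^ (1 / α))) (by
      filter_upwards [hx01] with x hx
      have h5 := hT.norm_solE_sub_le hφ hα hθ hθ1 (hl.trans (by norm_num)) hx.1 hx.2
      rw [solE] at h5
      rw [(hul x hx.1).1, (hul x hx.1).2]
      have h6 : (l * solC' α θ φ T x + Complex.I * (l * solC α θ φ T x)) / l =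
          solC' α θ φ T x + Complex.I * solC α θ φ T x := by
        field_simp
      rw [h6]
      exact h5)
    linarith [norm_nonneg (A / l - θ * bornCoeff α)]

lemma norm_div_sub_le {a b γ : ℂ} {ε K D : ℝ} (hθ : 0 < θ) (hθε : θ ≤ ε)
    (hε1 : ε ≤ 1) (hD : 0 ≤ D) (hsmall : (K + ‖γ‖ + D) * ε ≤ 1 / 2)
    (hab : ‖a + b - 1‖ ≤ K * ε) (ha : ‖a - θ * γ‖ ≤ θ * (D * ε)) :
    b ≠ 0 ∧ ‖a / b / θ - γ‖ ≤ 2 * (D + ‖γ‖ * (K + ‖γ‖ + D)) * ε := by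
  have hε : 0 < ε := hθ.trans_le hθε
  have hθ0 : (θ : ℂ) ≠ 0 := Complex.ofReal_ne_zero.2 hθ.ne'
  have ha' : ‖a‖ ≤ (‖γ‖ + D) * ε := by
    calc ‖a‖ = ‖(a - θ * γ) + θ * γ‖ := by rw [sub_add_cancel]
      _ ≤ θ * (D * ε) + θ * ‖γ‖ := by
        refine (norm_add_le _ _).trans (add_le_add ha ?_)
        rw [norm_mul, Complex.norm_real, Real.norm_of_nonneg hθ.le]
      _ ≤ ε * (D * 1) + ε * ‖γ‖ := by gcongr
      _ = _ := by ring
  have hb1 : ‖1 - b‖ ≤ (K + ‖γ‖ + D) * ε := by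
    calc ‖1 - b‖ = ‖a - (a + b - 1)‖ := by ring_nf
      _ ≤ (‖γ‖ + D) * ε + K * ε := (norm_sub_le _ _).trans (add_le_add ha' hab)
      _ = _ := by ring
  have hb2 : 1 / 2 ≤ ‖b‖ := by
    have := norm_sub_norm_le 1 (1 - b)
    rw [sub_sub_cancel, norm_one] at this
    linarith
  have hb0 : b ≠ 0 := norm_pos_iff.1 (by linarith)
  refine ⟨hb0, ?_⟩
  have key : a / b / θ - γ = ((a - θ * γ) / θ + γ * (1 - b)) / b := by
    field_simp
    ring
  rw [key, norm_div, div_le_iff₀ (norm_pos_iff.2 hb0)]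
  have h1 : ‖(a - θ * γ) / θ‖ ≤ D * ε := by
    rw [norm_div, Complex.norm_real, Real.norm_of_nonneg hθ.le, div_le_iff₀ hθ]
    linarith
  have hX : 0 ≤ K + ‖γ‖ + D := by
    have := (norm_nonneg _).trans hb1
    exact nonneg_of_mul_nonneg_left this hε
  calc _ ≤ D * ε + ‖γ‖ * ((K + ‖γ‖ + D) * ε) := by
        refine (norm_add_le _ _).trans (add_le_add h1 ?_)
        rw [norm_mul]
        gcongr
    _ = 2 * (D + ‖γ‖ * (K + ‖γ‖ + D)) * ε * (1 / 2) := by ring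
    _ ≤ _ := by gcongr

end Connection

end WKB

/-- rate of convergence of `R/θ` to `Γ(α+1)/(2i)^{α+2}` for `α ≥ 1`. -/
theorem stmt12 (α x₀ : ℝ) (hα : 1 ≤ α) (hx₀ : 0 < x₀) :
    ∃ C > (0:ℝ), ∃ θ₁ > (0:ℝ), ∀ θ : ℝ, 0 < θ → θ < θ₁ →
      Mtail α θ x₀ < 2 ∧
      ∀ S : ℝ → ℂ, IsVolterraSol α θ x₀ S →
        ∀ u u' : ℝ → ℂ,
          (∀ x : ℝ, HasDerivAt u (u' x) x) →
          (∀ x : ℝ, HasDerivAt u' (-((spd α θ x : ℂ))⁻¹ ^ 2 * u x) x) →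
          (∀ x ∈ Ici x₀, u x = S x * vminus α θ x) →
          ∀ A B : ℂ,
            (∀ x : ℝ, x ≤ 0 →
              u x = B * Complex.exp (-Complex.I * (x : ℂ)) +
                A * Complex.exp (Complex.I * (x : ℂ))) →
            B ≠ 0 ∧
              ‖A / B / (θ : ℂ) -
                  (Real.Gamma (α + 1) : ℂ) / (2 * Complex.I) ^ ((α : ℂ) + 2)‖ ≤
                C * θ ^ (1 / α) := by
  have hα0 : 0 < α := by linarith
  have hc := WKB.cM_pos hα
  have hD := WKB.cE_nonneg hα
  set γ := WKB.bornCoeff α with hγ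
  set K := 4 * WKB.cM α + 2 with hK
  set L := K + ‖γ‖ + WKB.cE α with hL
  have hγ0 := norm_nonneg γ
  have hL0 : 0 < L := by linarith
  have hX : 0 < 8 * (L + WKB.cM α + 1) := by linarith
  set δ : ℝ := (8 * (L + WKB.cM α + 1))⁻¹ with hδ
  have hδ0 : 0 < δ := inv_pos.2 hX
  have hδX : 8 * (L + WKB.cM α + 1) * δ = 1 := mul_inv_cancel₀ hX.ne'
  refine ⟨2 * (WKB.cE α + ‖γ‖ * L) + 1, by positivity, δ ^ α, by positivity, fun θ hθ hθδ => ?_⟩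
  have hδ1 : δ ≤ 1 := inv_le_one_of_one_le₀ (by linarith)
  have hθ1 : θ ≤ 1 := hθδ.le.trans (Real.rpow_le_one hδ0.le hδ1 hα0.le)
  have hεδ : θ ^ (1 / α) ≤ δ := by
    rw [one_div]
    exact (Real.rpow_inv_le_iff_of_pos hθ.le hδ0.le hα0).2 hθδ.le
  have hε0 : 0 < θ ^ (1 / α) := Real.rpow_pos_of_pos hθ _
  have hcε : WKB.cM α * θ ^ (1 / α) ≤ 1 / 8 := by
    have := mul_le_mul_of_nonneg_left hεδ hc.le
    have h1 : 0 ≤ L * δ := by positivity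
    linarith
  have hLε : L * θ ^ (1 / α) ≤ 1 / 2 := by
    have := mul_le_mul_of_nonneg_left hεδ hL0.le
    have h1 : 0 ≤ WKB.cM α * δ := by positivity
    linarith
  refine ⟨(WKB.Mtail_le hα hθ hx₀).trans_lt (by linarith), ?_⟩
  intro S hS u u' hu hu' huS A B hAB
  obtain ⟨l, hl, h1, h2⟩ := WKB.exists_normalized_coeffs hα hθ hθ1 hcε hx₀ hS hu hu' huS hAB
  obtain ⟨hb, h3⟩ := WKB.norm_div_sub_le hθ (WKB.le_rpow_one_div hα hθ hθ1)
    (hεδ.trans hδ1) hD hLε h1 h2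
  rw [div_div_div_cancel_right₀ hl] at h3
  refine ⟨fun hB => hb (by rw [hB, zero_div]), h3.trans ?_⟩
  gcongr
  linarith
end
end

section
/- For every α > 0 and every x₀ > 0 there exists θ₀(x₀) > 0 such that for all 0 < θ < θ₀(x₀) one has M_{x₀} = ∫_{x₀}^∞ |M(x)| dx < 2. -/
open MeasureTheory Set Filter Topology

noncomputable section

/-- The power profile `y ↦ (1 + θ y^α)^p` has the expected derivative on `(0,∞)`. -/
theorem hasDerivAt_one_add_mul_rpow_rpow {α θ x : ℝ} (p : ℝ) (hθ : 0 < θ) (hx : 0 < x) :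
    HasDerivAt (fun y : ℝ => (1 + θ * y ^ α) ^ p)
      (θ * (α * x ^ (α - 1)) * p * (1 + θ * x ^ α) ^ (p - 1)) x := by
  have hw : 0 < 1 + θ * x ^ α := by positivity
  exact (((Real.hasDerivAt_rpow_const (Or.inl hx.ne')).const_mul θ).const_add 1).rpow_const
    (Or.inl hw.ne')

theorem spd_rpow_half {α θ x : ℝ} (hθ : 0 < θ) (hx : 0 < x) :
    spd α θ x ^ ((1 : ℝ) / 2) = (1 + θ * x ^ α) ^ (-(1 / 4) : ℝ) := by
  have hw : 0 < 1 + θ * x ^ α := by positivity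
  rw [spd, max_eq_left hx.le, ← Real.rpow_mul hw.le]
  norm_num

theorem deriv_spd_rpow_half {α θ x : ℝ} (hθ : 0 < θ) (hx : 0 < x) :
    deriv (fun y => spd α θ y ^ ((1 : ℝ) / 2)) x =
      θ * (α * x ^ (α - 1)) * (-(1 / 4)) * (1 + θ * x ^ α) ^ (-(5 / 4) : ℝ) := by
  have h : (fun y => spd α θ y ^ ((1 : ℝ) / 2)) =ᶠ[𝓝 x]
      fun y => (1 + θ * y ^ α) ^ (-(1 / 4) : ℝ) := by
    filter_upwards [Ioi_mem_nhds hx] with y hy using spd_rpow_half hθ hy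
  rw [h.deriv_eq, (hasDerivAt_one_add_mul_rpow_rpow _ hθ hx).deriv]
  norm_num

theorem deriv_deriv_spd_rpow_half {α θ x : ℝ} (hθ : 0 < θ) (hx : 0 < x) :
    deriv (deriv (fun y => spd α θ y ^ ((1 : ℝ) / 2))) x =
      θ * (α * ((α - 1) * x ^ (α - 2))) * (-(1 / 4)) * (1 + θ * x ^ α) ^ (-(5 / 4) : ℝ) +
        θ * (α * x ^ (α - 1)) * (-(1 / 4)) *
          (θ * (α * x ^ (α - 1)) * (-(5 / 4)) * (1 + θ * x ^ α) ^ (-(9 / 4) : ℝ)) := by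
  have h : deriv (fun y => spd α θ y ^ ((1 : ℝ) / 2)) =ᶠ[𝓝 x]
      fun y => θ * (α * y ^ (α - 1)) * (-(1 / 4)) * (1 + θ * y ^ α) ^ (-(5 / 4) : ℝ) := by
    filter_upwards [Ioi_mem_nhds hx] with y hy using deriv_spd_rpow_half hθ hy
  have h₁ := (((Real.hasDerivAt_rpow_const (p := α - 1) (Or.inl hx.ne')).const_mul α).const_mul
    θ).mul_const (-(1 / 4))
  have h₂ := h₁.fun_mul (hasDerivAt_one_add_mul_rpow_rpow (α := α) (-(5 / 4)) hθ hx)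
  rw [h.deriv_eq, h₂.deriv]
  norm_num [show α - 1 - 1 = α - 2 by ring]

theorem Mfun_eq {α θ x : ℝ} (hθ : 0 < θ) (hx : 0 < x) :
    Mfun α θ x = x ^ (-2 : ℝ) *
      (5 / 16 * α ^ 2 * ((θ * x ^ α) ^ 2 * (1 + θ * x ^ α) ^ (-(5 / 2) : ℝ)) -
        α * (α - 1) / 4 * (θ * x ^ α * (1 + θ * x ^ α) ^ (-(3 / 2) : ℝ))) := by
  have hw : 0 < 1 + θ * x ^ α := by positivity
  rw [Mfun, if_pos hx, spd_rpow_half hθ hx, deriv_deriv_spd_rpow_half hθ hx,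
    show (-(5 / 2) : ℝ) = -(1 / 4) + -(9 / 4) by norm_num,
    show (-(3 / 2) : ℝ) = -(1 / 4) + -(5 / 4) by norm_num,
    Real.rpow_add hw, Real.rpow_add hw, Real.rpow_sub hx, Real.rpow_sub hx, Real.rpow_neg hx.le,
    Real.rpow_one, Real.rpow_two]
  field_simp
  ring

theorem mul_one_add_rpow_le_rpow {u s : ℝ} (hu : 0 < u) (hs₀ : 0 ≤ s) (hs₁ : s ≤ 1) :
    u * (1 + u) ^ (-(3 / 2) : ℝ) ≤ u ^ s :=
  calc u * (1 + u) ^ (-(3 / 2) : ℝ) ≤ u * (1 + u) ^ (s - 1) := by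
        have : 1 ≤ 1 + u := by linarith
        gcongr
        linarith
    _ ≤ u * u ^ (s - 1) := by
        refine mul_le_mul_of_nonneg_left ?_ hu.le
        exact Real.rpow_le_rpow_of_nonpos hu (by linarith) (by linarith)
    _ = u ^ s := by
        rw [Real.rpow_sub_one hu.ne']
        field_simp

theorem sq_mul_one_add_rpow_le {u : ℝ} (hu : 0 < u) :
    u ^ 2 * (1 + u) ^ (-(5 / 2) : ℝ) ≤ u * (1 + u) ^ (-(3 / 2) : ℝ) := by
  have hw : 0 < 1 + u := by positivity
  rw [show (-(3 / 2) : ℝ) = -(5 / 2) + 1 by norm_num, Real.rpow_add_one hw.ne']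
  have : 0 ≤ (1 + u) ^ (-(5 / 2) : ℝ) := by positivity
  nlinarith [mul_nonneg hu.le this]

theorem abs_Mfun_le {α θ x s : ℝ} (hθ : 0 < θ) (hx : 0 < x) (hs₀ : 0 ≤ s) (hs₁ : s ≤ 1) :
    |Mfun α θ x| ≤ (5 / 16 * α ^ 2 + |α * (α - 1) / 4|) * θ ^ s * x ^ (α * s - 2) := by
  have hu : 0 < θ * x ^ α := by positivity
  have h₁ := mul_one_add_rpow_le_rpow hu hs₀ hs₁
  have h₂ := (sq_mul_one_add_rpow_le hu).trans h₁
  rw [Mfun_eq hθ hx, abs_mul, abs_of_pos (by positivity : 0 < x ^ (-2 : ℝ))]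
  calc _ ≤ x ^ (-2 : ℝ) * (5 / 16 * α ^ 2 * (θ * x ^ α) ^ s +
          |α * (α - 1) / 4| * (θ * x ^ α) ^ s) := by
        gcongr
        refine (abs_sub _ _).trans (add_le_add ?_ ?_)
        · rw [abs_of_nonneg (by positivity)]
          gcongr
        · rw [abs_mul, abs_of_pos (a := θ * x ^ α * _) (by positivity)]
          gcongr
    _ = _ := by
        rw [Real.mul_rpow hθ.le (by positivity), ← Real.rpow_mul hx.le,
          show α * s - 2 = -2 + α * s by ring, Real.rpow_add hx]
        ring

theorem Mtail_le {α θ x₀ s : ℝ} (hθ : 0 < θ) (hx₀ : 0 < x₀) (hs₀ : 0 ≤ s) (hs₁ : s ≤ 1)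
    (hαs : α * s < 1) :
    Mtail α θ x₀ ≤ (5 / 16 * α ^ 2 + |α * (α - 1) / 4|) * θ ^ s *
      ∫ x in Ioi x₀, x ^ (α * s - 2) := by
  rw [Mtail, ← integral_const_mul]
  refine integral_mono_of_nonneg (Eventually.of_forall fun x => abs_nonneg _)
    ((integrableOn_Ioi_rpow_of_lt (by linarith) hx₀).const_mul _) ?_
  filter_upwards [ae_restrict_mem measurableSet_Ioi] with x hx
  exact abs_Mfun_le hθ (hx₀.trans hx) hs₀ hs₁

/-- smallness of `M_{x₀}` for small `θ`. -/
theorem stmt13 (α x₀ : ℝ) (hα : 0 < α) (hx₀ : 0 < x₀) :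
    ∃ θ₀ > (0:ℝ), ∀ θ : ℝ, 0 < θ → θ < θ₀ → Mtail α θ x₀ < 2 := by
  set s := 1 / (1 + α) with hs
  have hs₀ : 0 < s := by positivity
  have hs₁ : s ≤ 1 := by rw [hs, div_le_one (by positivity)]; linarith
  have hαs : α * s < 1 := by rw [hs, mul_one_div, div_lt_one (by positivity)]; linarith
  have hlim : Tendsto (fun θ : ℝ => (5 / 16 * α ^ 2 + |α * (α - 1) / 4|) * θ ^ s *
      ∫ x in Ioi x₀, x ^ (α * s - 2)) (𝓝[>] 0) (𝓝 0) := by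
    have h : Tendsto (fun θ : ℝ => θ ^ s) (𝓝[>] 0) (𝓝 0) := by
      simpa [Real.zero_rpow hs₀.ne'] using
        (Real.continuousAt_rpow_const 0 s (Or.inr hs₀.le)).tendsto.mono_left nhdsWithin_le_nhds
    simpa using (h.const_mul _).mul_const _
  obtain ⟨θ₀, hθ₀, h⟩ := mem_nhdsGT_iff_exists_Ioo_subset.1
    (hlim.eventually_lt_const (by norm_num : (0 : ℝ) < 2))
  exact ⟨θ₀, hθ₀, fun θ h₁ h₂ => (Mtail_le h₁ hx₀ hs₀.le hs₁ hαs).trans_lt (h ⟨h₁, h₂⟩)⟩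
end
end
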